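/- arXiv:1303.4005 — 2 statements merged into one kernel-verified Lean document; each statement's English description precedes it below -/
import Mathlib

section
/- Let X, X₁, …, Xₙ be i.i.d. real-valued random variables with q := P(X₁ − X₂ ≠ 0) > 0, and let a = (a₁, …, aₙ) with aₖ ∈ ℝ^d be such that 𝑁 = Σₖ aₖaₖᵀ is positive definite. Let D > 0 and α > 0, and suppose Σₖ(⟨t,aₖ⟩ − mₖ)² ≥ α² for all integers m₁, …, mₙ and all t ∈ ℝ^d with ‖t‖ ≤ D and maxₖ|⟨t,aₖ⟩| ≥ 1/2. Then there exist absolute constants c₁, c₂ > 0 such that sup_{x∈ℝ^d} P(Σₖ Xₖaₖ = x) ≤ c₁^d ( (√d/(D √q))^d (det 𝑁)^{-1/2} + exp(−c₂ α² q) ). -/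
open MeasureTheory
open scoped RealInnerProductSpace

/-- Concentration function `Q(μ, r) = sup_x μ(x + rB)` of a measure on `ℝ^d`. -/
noncomputable def concFn {d : ℕ} (μ : Measure (EuclideanSpace ℝ (Fin d))) (r : ℝ) : ℝ :=
  ⨆ x : EuclideanSpace ℝ (Fin d), (μ (Metric.closedBall x r)).toReal

/-- Law of `S_a = ∑ k, X_k • a_k`, where `X_1, …, X_n` are i.i.d. with law `ν`. -/
noncomputable def sumLaw {d n : ℕ} (ν : Measure ℝ) (a : Fin n → EuclideanSpace ℝ (Fin d)) :
    Measure (EuclideanSpace ℝ (Fin d)) :=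
  (Measure.pi fun _ : Fin n => ν).map (fun ω => ∑ k, ω k • a k)

/-- `M(τ) = E min(X̃²/τ², 1)`, where `X̃ = X₁ - X₂` with `X₁, X₂` i.i.d. of law `ν`. -/
noncomputable def Mfn (ν : Measure ℝ) (τ : ℝ) : ℝ :=
  ∫ p : ℝ × ℝ, min ((p.1 - p.2) ^ 2 / τ ^ 2) 1 ∂(ν.prod ν)

/-- The matrix `𝑁 = ∑ k, aₖ aₖᵀ`. -/
noncomputable def covMat {d n : ℕ} (a : Fin n → EuclideanSpace ℝ (Fin d)) :
    Matrix (Fin d) (Fin d) ℝ :=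
  Matrix.of fun i j => ∑ k, a k i * a k j

/-- The squared Euclidean distance from a vector to the integer lattice. -/
noncomputable def sqDistInt {n : ℕ} (v : Fin n → ℝ) : ℝ :=
  ∑ k, ‖(v k : UnitAddCircle)‖ ^ 2

lemma sqDistInt_nonneg {n : ℕ} (v : Fin n → ℝ) : 0 ≤ sqDistInt v := by
  unfold sqDistInt; positivity

lemma sqDistInt_zero {n : ℕ} : sqDistInt (0 : Fin n → ℝ) = 0 := by
  simp [sqDistInt]

lemma continuous_sqDistInt {n : ℕ} : Continuous (sqDistInt : (Fin n → ℝ) → ℝ) := by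
  unfold sqDistInt
  refine continuous_finsetSum _ fun k _ => ?_
  exact ((AddCircle.continuous_mk' 1).comp (continuous_apply k)).norm.pow 2

lemma sqDistInt_le_card {n : ℕ} (v : Fin n → ℝ) : sqDistInt v ≤ n := by
  unfold sqDistInt
  calc _ ≤ ∑ _k : Fin n, (1 : ℝ) := by
        refine Finset.sum_le_sum fun k _ => ?_
        have h := AddCircle.norm_le_half_period (1 : ℝ) one_ne_zero (x := (v k : UnitAddCircle))
        have h0 := norm_nonneg (v k : UnitAddCircle)
        norm_num at h
        nlinarith
    _ = n := by simp

lemma sqDistInt_sub_le {n : ℕ} (v w : Fin n → ℝ) :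
    sqDistInt (v - w) ≤ 2 * sqDistInt v + 2 * sqDistInt w := by
  unfold sqDistInt
  rw [Finset.mul_sum, Finset.mul_sum, ← Finset.sum_add_distrib]
  refine Finset.sum_le_sum fun k _ => ?_
  have h := norm_sub_le (v k : UnitAddCircle) (w k : UnitAddCircle)
  have h0 := norm_nonneg ((v k : UnitAddCircle) - (w k : UnitAddCircle))
  simp only [Pi.sub_apply, AddCircle.coe_sub]
  nlinarith [sq_nonneg (‖(v k : UnitAddCircle)‖ - ‖(w k : UnitAddCircle)‖)]

lemma sqDistInt_eq_sum_sq {n : ℕ} {v : Fin n → ℝ} (hv : ∀ k, |v k| ≤ 1 / 2) :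
    sqDistInt v = ∑ k, v k ^ 2 := by
  unfold sqDistInt
  refine Finset.sum_congr rfl fun k _ => ?_
  rw [(AddCircle.norm_coe_eq_abs_iff (1 : ℝ) one_ne_zero).2 (by simpa using hv k), sq_abs]

lemma sqDistInt_eq_sum_round {n : ℕ} (v : Fin n → ℝ) :
    sqDistInt v = ∑ k, (v k - round (v k)) ^ 2 := by
  simp [sqDistInt, UnitAddCircle.norm_eq]

open scoped MatrixOrder in
lemma Matrix.PosDef.exists_transpose_mul_self_real {d : ℕ} {N : Matrix (Fin d) (Fin d) ℝ}
    (hN : N.PosDef) : ∃ M : Matrix (Fin d) (Fin d) ℝ, N = M.transpose * M := by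
  refine ⟨CFC.sqrt N, ?_⟩
  have h := (Matrix.nonneg_iff_posSemidef.1 (CFC.sqrt_nonneg N)).isHermitian
  rw [Matrix.IsHermitian, Matrix.conjTranspose_eq_transpose_of_trivial] at h
  rw [h, CFC.sqrt_mul_sqrt_self N hN.posSemidef.nonneg]

lemma lintegral_exp_neg_sum_sq {d : ℕ} {q : ℝ} (hq : 0 < q) :
    ∫⁻ t : Fin d → ℝ, ENNReal.ofReal (Real.exp (-q * ∑ i, t i ^ 2)) =
      ENNReal.ofReal (Real.sqrt (Real.pi / q) ^ d) := by
  have h : ∀ t : Fin d → ℝ, Real.exp (-q * ∑ i, t i ^ 2) = ∏ i, Real.exp (-q * t i ^ 2) := by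
    intro t
    rw [Finset.mul_sum, Real.exp_sum]
  simp_rw [h]
  rw [← ofReal_integral_eq_lintegral_ofReal]
  · rw [integral_fintype_prod_volume_eq_pow (fun x : ℝ => Real.exp (-q * x ^ 2)),
      integral_gaussian, Fintype.card_fin]
  · exact Integrable.fintype_prod (f := fun (_ : Fin d) x => Real.exp (-q * x ^ 2))
      (fun _ => integrable_exp_neg_mul_sq hq)
  · exact Filter.Eventually.of_forall fun t => Finset.prod_nonneg fun i _ => (Real.exp_pos _).le

open Matrix in
/-- The Gaussian integral of a positive definite quadratic form `t ↦ ‖A t‖²`. -/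
lemma lintegral_exp_neg_sum_mulVec_sq {d n : ℕ} {q : ℝ} (hq : 0 < q)
    (A : Matrix (Fin n) (Fin d) ℝ) (hA : (Aᵀ * A).PosDef) :
    ∫⁻ t : Fin d → ℝ, ENNReal.ofReal (Real.exp (-q * ∑ k, (A *ᵥ t) k ^ 2)) =
      ENNReal.ofReal (Real.sqrt (Real.pi / q) ^ d * (1 / Real.sqrt (Aᵀ * A).det)) := by
  obtain ⟨M, hM⟩ := hA.exists_transpose_mul_self_real
  have hdet : (Aᵀ * A).det = M.det ^ 2 := by
    rw [hM, det_mul, det_transpose, sq]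
  have hM0 : M.det ≠ 0 := by
    intro h
    have := hA.det_pos
    rw [hdet, h] at this
    norm_num at this
  have key : ∀ t : Fin d → ℝ, ∑ k, (A *ᵥ t) k ^ 2 = ∑ i, (toLin' M t) i ^ 2 := by
    intro t
    have h1 : ∑ k, (A *ᵥ t) k ^ 2 = (A *ᵥ t) ⬝ᵥ (A *ᵥ t) := by simp [dotProduct, sq]
    have h2 : ∑ i, (M *ᵥ t) i ^ 2 = (M *ᵥ t) ⬝ᵥ (M *ᵥ t) := by simp [dotProduct, sq]
    rw [toLin'_apply, h1, h2, dotProduct_mulVec, dotProduct_mulVec, ← mulVec_transpose,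
      ← mulVec_transpose, mulVec_mulVec, mulVec_mulVec, hM]
  simp_rw [key]
  have hmeas : Measurable fun t : Fin d → ℝ => ENNReal.ofReal (Real.exp (-q * ∑ i, t i ^ 2)) := by
    fun_prop
  have hlin : Measurable (toLin' M) :=
    (LinearMap.continuous_of_finiteDimensional _).measurable
  rw [← lintegral_map (μ := volume) hmeas hlin, Real.map_matrix_volume_pi_eq_smul_volume_pi hM0,
    lintegral_smul_measure, lintegral_exp_neg_sum_sq hq, smul_eq_mul,
    ← ENNReal.ofReal_mul (abs_nonneg _), hdet, Real.sqrt_sq_eq_abs, abs_inv, mul_comm, one_div]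

open Matrix in
/-- Integral bound over a cube on which differences of near-integral points are small. -/
lemma setLIntegral_Icc_exp_sqDistInt_le {d n : ℕ} {q l α : ℝ} (hq : 0 < q) (hl : 0 < l)
    (hα : 0 < α) (A : Matrix (Fin n) (Fin d) ℝ) (hA : (Aᵀ * A).PosDef)
    (H : ∀ t : Fin d → ℝ, (∀ j, |t j| ≤ l) → (∃ k, 1 / 2 ≤ |(A *ᵥ t) k|) →
      α ^ 2 ≤ sqDistInt (A *ᵥ t)) (u : Fin d → ℝ) :
    ∫⁻ s in Set.Icc u (fun j => u j + l),
        ENNReal.ofReal (Real.exp (-(4 * q) * sqDistInt (A *ᵥ s))) ≤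
      ENNReal.ofReal (Real.sqrt (Real.pi / q) ^ d * (1 / Real.sqrt (Aᵀ * A).det) +
        l ^ d * Real.exp (-(4 / 5) * α ^ 2 * q)) := by
  have hAc : Continuous fun s : Fin d → ℝ => sqDistInt (A *ᵥ s) :=
    continuous_sqDistInt.comp (continuous_const.matrix_mulVec continuous_id)
  set Q : Set (Fin d → ℝ) := Set.Icc u (fun j => u j + l) with hQ
  set E : Set (Fin d → ℝ) := Q ∩ {s | sqDistInt (A *ᵥ s) ≤ α ^ 2 / 5} with hE
  have hEcomp : IsCompact E := isCompact_Icc.inter_right (isClosed_le hAc continuous_const)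
  obtain ⟨s₀, hs₀⟩ : ∃ s₀ : Fin d → ℝ, ∀ s ∈ E,
      Real.exp (-(4 * q) * sqDistInt (A *ᵥ s)) ≤
        Real.exp (-q * ∑ k, (A *ᵥ (s - s₀)) k ^ 2) := by
    rcases E.eq_empty_or_nonempty with h | h
    · exact ⟨0, by simp [h]⟩
    obtain ⟨s₀, hs₀E, hmin⟩ := hEcomp.exists_isMinOn h hAc.continuousOn
    refine ⟨s₀, fun s hs => ?_⟩
    have hle : sqDistInt (A *ᵥ s₀) ≤ sqDistInt (A *ᵥ s) := hmin hs
    have hsub : sqDistInt (A *ᵥ (s - s₀)) ≤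
        2 * sqDistInt (A *ᵥ s) + 2 * sqDistInt (A *ᵥ s₀) := by
      rw [mulVec_sub]; exact sqDistInt_sub_le _ _
    have hsα : sqDistInt (A *ᵥ s) ≤ α ^ 2 / 5 := hs.2
    have hsmall : ∀ k, |(A *ᵥ (s - s₀)) k| ≤ 1 / 2 := by
      by_contra! hk
      obtain ⟨k, hk⟩ := hk
      have := H (s - s₀) (fun j => by
        have h1 := hs.1.1 j
        have h2 := hs.1.2 j
        have h3 := hs₀E.1.1 j
        have h4 := hs₀E.1.2 j
        simp only [Pi.sub_apply] at *
        rw [abs_le]; constructor <;> linarith) ⟨k, hk.le⟩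
      nlinarith [pow_pos hα 2]
    rw [← sqDistInt_eq_sum_sq hsmall]
    apply Real.exp_le_exp.2
    nlinarith
  have hpt : ∀ s ∈ Q, ENNReal.ofReal (Real.exp (-(4 * q) * sqDistInt (A *ᵥ s))) ≤
      ENNReal.ofReal (Real.exp (-q * ∑ k, (A *ᵥ (s - s₀)) k ^ 2)) +
        ENNReal.ofReal (Real.exp (-(4 / 5) * α ^ 2 * q)) := by
    intro s hs
    by_cases hsE : sqDistInt (A *ᵥ s) ≤ α ^ 2 / 5
    · exact (ENNReal.ofReal_le_ofReal (hs₀ s ⟨hs, hsE⟩)).trans le_self_add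
    · refine le_trans (ENNReal.ofReal_le_ofReal (Real.exp_le_exp.2 ?_)) le_add_self
      nlinarith
  have hdet : 0 < (Aᵀ * A).det := hA.det_pos
  calc _ ≤ ∫⁻ s in Q, (ENNReal.ofReal (Real.exp (-q * ∑ k, (A *ᵥ (s - s₀)) k ^ 2)) +
        ENNReal.ofReal (Real.exp (-(4 / 5) * α ^ 2 * q))) :=
        setLIntegral_mono' measurableSet_Icc hpt
    _ = (∫⁻ s in Q, ENNReal.ofReal (Real.exp (-q * ∑ k, (A *ᵥ (s - s₀)) k ^ 2))) +
        ENNReal.ofReal (Real.exp (-(4 / 5) * α ^ 2 * q)) * volume Q := by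
        rw [lintegral_add_right _ measurable_const, setLIntegral_const]
    _ ≤ (∫⁻ s, ENNReal.ofReal (Real.exp (-q * ∑ k, (A *ᵥ (s - s₀)) k ^ 2))) +
        ENNReal.ofReal (Real.exp (-(4 / 5) * α ^ 2 * q)) * volume Q := by
        gcongr
        exact Measure.restrict_le_self
    _ = _ := by
        rw [lintegral_sub_right_eq_self
          (fun s => ENNReal.ofReal (Real.exp (-q * ∑ k, (A *ᵥ s) k ^ 2))) s₀,
          lintegral_exp_neg_sum_mulVec_sq hq A hA, hQ, Real.volume_Icc_pi]
        simp only [add_sub_cancel_left, Finset.prod_const, Finset.card_univ, Fintype.card_fin]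
        rw [← ENNReal.ofReal_pow hl.le, ← ENNReal.ofReal_mul (Real.exp_pos _).le,
          ← ENNReal.ofReal_add (by positivity) (by positivity), mul_comm (Real.exp _)]

lemma setLIntegral_Icc_comp_add_right {d : ℕ} (F : (Fin d → ℝ) → ENNReal) (v a b : Fin d → ℝ) :
    ∫⁻ s in Set.Icc a b, F (s + v) = ∫⁻ s in Set.Icc (a + v) (b + v), F s := by
  rw [← lintegral_indicator measurableSet_Icc, ← lintegral_indicator measurableSet_Icc,
    ← lintegral_add_right_eq_self ((Set.Icc (a + v) (b + v)).indicator F) v]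
  congr 1 with s
  have hs : s + v ∈ Set.Icc (a + v) (b + v) ↔ s ∈ Set.Icc a b := by
    rw [Set.mem_Icc, Set.mem_Icc, add_le_add_iff_right, add_le_add_iff_right]
  by_cases h : s ∈ Set.Icc a b
  · rw [Set.indicator_of_mem h, Set.indicator_of_mem (hs.2 h)]
  · rw [Set.indicator_of_notMem h, Set.indicator_of_notMem (mt hs.1 h)]

/-- Comparison of the integrals of a function over a large cube and over small cubes. -/
lemma setLIntegral_Icc_le_of_small_cubes {d : ℕ} {F : (Fin d → ℝ) → ENNReal} (hF : Measurable F)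
    {l T : ℝ} (hl : 0 < l) (hlT : l ≤ T) {K : ENNReal}
    (hK : ∀ u : Fin d → ℝ, ∫⁻ s in Set.Icc u (fun j => u j + l), F s ≤ K) (u : Fin d → ℝ) :
    ENNReal.ofReal (l ^ d) * ∫⁻ s in Set.Icc u (fun j => u j + T), F s ≤
      ENNReal.ofReal ((2 * T) ^ d) * K := by
  set V : Set (Fin d → ℝ) := Set.Icc 0 (fun _ => l)
  set W : Set (Fin d → ℝ) := Set.Icc (fun j => u j - l) (fun j => u j + T)
  have hvolV : volume V = ENNReal.ofReal (l ^ d) := by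
    simp [V, Real.volume_Icc_pi, ENNReal.ofReal_pow hl.le]
  have hvolW : volume W ≤ ENNReal.ofReal ((2 * T) ^ d) := by
    have : ∀ j, u j + T - (u j - l) = T + l := fun j => by ring
    simp only [W, Real.volume_Icc_pi, this, Finset.prod_const, Finset.card_univ, Fintype.card_fin]
    rw [← ENNReal.ofReal_pow (by linarith)]
    gcongr
    · linarith
    · linarith
  calc _ = ∫⁻ _v in V, ∫⁻ s in Set.Icc u (fun j => u j + T), F s := by
        rw [setLIntegral_const, hvolV, mul_comm]
    _ ≤ ∫⁻ v in V, ∫⁻ w in W, F (w + v) := by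
        refine setLIntegral_mono' measurableSet_Icc fun v hv => ?_
        rw [setLIntegral_Icc_comp_add_right]
        refine lintegral_mono_set (Set.Icc_subset_Icc ?_ ?_)
        · intro j
          have := hv.2 j
          simp only [Pi.add_apply]
          linarith
        · intro j
          have := hv.1 j
          simp only [Pi.add_apply, Pi.zero_apply] at *
          linarith
    _ = ∫⁻ w in W, ∫⁻ v in V, F (w + v) := by
        refine lintegral_lintegral_swap ?_
        exact (hF.comp (measurable_snd.add measurable_fst)).aemeasurable
    _ ≤ ∫⁻ _w in W, K := by
        refine lintegral_mono fun w => ?_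
        simp_rw [add_comm w]
        rw [setLIntegral_Icc_comp_add_right]
        convert hK w using 4
        · simp
        · ext j; simp [add_comm]
    _ ≤ _ := by
        rw [setLIntegral_const, mul_comm]
        gcongr

/-- For a measurable family of characters `e ω`, the second moment of the transform of `κ` is
bounded by the average over differences of the norm of the expectation of `e`. -/
lemma integrable_and_integral_norm_sq_le {Ω G : Type*} [MeasurableSpace Ω] [MeasurableSpace G]
    [AddGroup G] [MeasurableSub₂ G] (P : Measure Ω) [IsProbabilityMeasure P]
    (κ : Measure G) [IsProbabilityMeasure κ] (e : Ω → G → ℂ)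
    (he : Measurable fun z : Ω × G => e z.1 z.2) (he_norm : ∀ ω t, ‖e ω t‖ = 1)
    (he_sub : ∀ ω t t', e ω (t - t') = e ω t * (starRingEnd ℂ) (e ω t')) :
    Integrable (fun ω => ‖∫ t, e ω t ∂κ‖ ^ 2) P ∧
      ∫ ω, ‖∫ t, e ω t ∂κ‖ ^ 2 ∂P ≤ ∫ p, ‖∫ ω, e ω (p.1 - p.2) ∂P‖ ∂(κ.prod κ) := by
  have hG : ∀ ω, ((‖∫ t, e ω t ∂κ‖ ^ 2 : ℝ) : ℂ) = ∫ p, e ω (p.1 - p.2) ∂(κ.prod κ) := by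
    intro ω
    simp_rw [he_sub]
    rw [integral_prod_mul (fun t => e ω t) (fun t => (starRingEnd ℂ) (e ω t)), integral_conj,
      Complex.mul_conj, Complex.normSq_eq_norm_sq]
  have hmeas : Measurable fun z : Ω × (G × G) => e z.1 (z.2.1 - z.2.2) :=
    he.comp (measurable_fst.prodMk
      ((measurable_fst.comp measurable_snd).sub (measurable_snd.comp measurable_snd)))
  have hint : Integrable (fun z : Ω × (G × G) => e z.1 (z.2.1 - z.2.2)) (P.prod (κ.prod κ)) :=
    Integrable.of_bound hmeas.aestronglyMeasurable 1
      (Filter.Eventually.of_forall fun z => (he_norm _ _).le)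
  have h1 : Integrable (fun ω => ((‖∫ t, e ω t ∂κ‖ ^ 2 : ℝ) : ℂ)) P := by
    simp_rw [hG]
    exact hint.integral_prod_left
  have h2 : ((∫ ω, ‖∫ t, e ω t ∂κ‖ ^ 2 ∂P : ℝ) : ℂ) =
      ∫ p, ∫ ω, e ω (p.1 - p.2) ∂P ∂(κ.prod κ) := by
    rw [← integral_complex_ofReal]
    simp_rw [hG]
    exact integral_integral_swap hint
  refine ⟨by simpa only [RCLike.re_to_complex, Complex.ofReal_re] using h1.re, ?_⟩
  have h3 : ‖((∫ ω, ‖∫ t, e ω t ∂κ‖ ^ 2 ∂P : ℝ) : ℂ)‖ ≤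
      ∫ p, ‖∫ ω, e ω (p.1 - p.2) ∂P‖ ∂(κ.prod κ) := by
    rw [h2]; exact norm_integral_le_integral_norm _
  rw [Complex.norm_real] at h3
  exact (le_abs_self _).trans h3

open Matrix in
lemma norm_integral_pi_exp_eq_prod_norm_charFun {d n : ℕ} (ν : Measure ℝ) [IsProbabilityMeasure ν]
    (A : Matrix (Fin n) (Fin d) ℝ) (x t : Fin d → ℝ) :
    ‖∫ ω, Complex.exp (((ω ᵥ* A - x) ⬝ᵥ t : ℝ) * Complex.I) ∂(Measure.pi fun _ : Fin n => ν)‖ =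
      ∏ k, ‖charFun ν ((A *ᵥ t) k)‖ := by
  have h1 : ∀ ω : Fin n → ℝ, Complex.exp (((ω ᵥ* A - x) ⬝ᵥ t : ℝ) * Complex.I) =
      Complex.exp (((-(x ⬝ᵥ t) : ℝ) : ℂ) * Complex.I) *
        ∏ k, Complex.exp (((A *ᵥ t) k : ℂ) * (ω k : ℂ) * Complex.I) := by
    intro ω
    rw [← Complex.exp_sum, ← Complex.exp_add, sub_dotProduct, ← dotProduct_mulVec]
    congr 1
    rw [← Finset.sum_mul, ← add_mul, dotProduct]
    push_cast
    rw [sub_eq_neg_add]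
    congr 3 with k
    ring
  simp_rw [h1]
  rw [integral_const_mul, norm_mul, Complex.norm_exp_ofReal_mul_I, one_mul,
    integral_fintype_prod_eq_prod
      (fun k (y : ℝ) => Complex.exp (((A *ᵥ t) k : ℂ) * (y : ℂ) * Complex.I)), norm_prod]
  simp_rw [charFun_apply_real]

open Matrix in
/-- The atom of a random linear combination is bounded by an average of characteristic functions. -/
lemma pi_fiber_le_lintegral_prod_norm_charFun {d n : ℕ} (ν : Measure ℝ) [IsProbabilityMeasure ν]
    (κ : Measure (Fin d → ℝ)) [IsProbabilityMeasure κ] (A : Matrix (Fin n) (Fin d) ℝ)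
    (x : Fin d → ℝ) :
    (Measure.pi fun _ : Fin n => ν) {ω | ω ᵥ* A = x} ≤
      ∫⁻ p, ENNReal.ofReal (∏ k, ‖charFun ν ((A *ᵥ (p.1 - p.2)) k)‖) ∂(κ.prod κ) := by
  set P := Measure.pi fun _ : Fin n => ν with hP
  have he_sub : ∀ (ω : Fin n → ℝ) (t t' : Fin d → ℝ),
      Complex.exp (((ω ᵥ* A - x) ⬝ᵥ (t - t') : ℝ) * Complex.I) =
        Complex.exp (((ω ᵥ* A - x) ⬝ᵥ t : ℝ) * Complex.I) *
          (starRingEnd ℂ) (Complex.exp (((ω ᵥ* A - x) ⬝ᵥ t' : ℝ) * Complex.I)) := by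
    intro ω t t'
    simp only [← Complex.exp_conj, ← Complex.exp_add, dotProduct_sub, map_mul, Complex.conj_I,
      Complex.conj_ofReal]
    congr 1
    push_cast
    ring
  have he_cont : Continuous fun z : (Fin n → ℝ) × (Fin d → ℝ) =>
      Complex.exp (((z.1 ᵥ* A - x) ⬝ᵥ z.2 : ℝ) * Complex.I) := by
    have : Continuous fun z : (Fin n → ℝ) × (Fin d → ℝ) => (z.1 ᵥ* A - x) ⬝ᵥ z.2 :=
      ((continuous_fst.matrix_vecMul continuous_const).sub continuous_const).dotProduct
        continuous_snd
    exact Complex.continuous_exp.comp ((Complex.continuous_ofReal.comp this).mul continuous_const)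
  obtain ⟨hint, hreal⟩ := integrable_and_integral_norm_sq_le P κ
    (fun ω t => Complex.exp (((ω ᵥ* A - x) ⬝ᵥ t : ℝ) * Complex.I)) he_cont.measurable
    (fun ω t => Complex.norm_exp_ofReal_mul_I _) he_sub
  simp only [hP, norm_integral_pi_exp_eq_prod_norm_charFun] at hreal
  rw [← hP] at hreal
  have hset : MeasurableSet {ω : Fin n → ℝ | ω ᵥ* A = x} :=
    (isClosed_eq (continuous_id.matrix_vecMul continuous_const) continuous_const).measurableSet
  have hφ : Continuous fun p : (Fin d → ℝ) × (Fin d → ℝ) =>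
      ∏ k, ‖charFun ν ((A *ᵥ (p.1 - p.2)) k)‖ := by
    refine continuous_finsetProd _ fun k _ => ?_
    have : Continuous fun p : (Fin d → ℝ) × (Fin d → ℝ) => (A *ᵥ (p.1 - p.2)) k :=
      (continuous_apply k).comp (continuous_const.matrix_mulVec (continuous_fst.sub continuous_snd))
    exact (continuous_charFun.comp this).norm
  have hφ0 : ∀ p : (Fin d → ℝ) × (Fin d → ℝ), 0 ≤ ∏ k, ‖charFun ν ((A *ᵥ (p.1 - p.2)) k)‖ :=
    fun p => Finset.prod_nonneg fun k _ => norm_nonneg _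
  calc P {ω | ω ᵥ* A = x}
      = ∫⁻ ω, {ω | ω ᵥ* A = x}.indicator 1 ω ∂P := (lintegral_indicator_one hset).symm
    _ ≤ ∫⁻ ω, ENNReal.ofReal
          (‖∫ t, Complex.exp (((ω ᵥ* A - x) ⬝ᵥ t : ℝ) * Complex.I) ∂κ‖ ^ 2) ∂P := by
        refine lintegral_mono fun ω => ?_
        by_cases hω : ω ᵥ* A = x
        · rw [Set.indicator_of_mem (show ω ∈ {ω | ω ᵥ* A = x} from hω)]
          simp [hω]
        · rw [Set.indicator_of_notMem (show ω ∉ {ω | ω ᵥ* A = x} from hω)]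
          exact bot_le
    _ = ENNReal.ofReal
          (∫ ω, ‖∫ t, Complex.exp (((ω ᵥ* A - x) ⬝ᵥ t : ℝ) * Complex.I) ∂κ‖ ^ 2 ∂P) :=
        (ofReal_integral_eq_lintegral_ofReal hint
          (Filter.Eventually.of_forall fun ω => sq_nonneg _)).symm
    _ ≤ ENNReal.ofReal (∫ p, ∏ k, ‖charFun ν ((A *ᵥ (p.1 - p.2)) k)‖ ∂(κ.prod κ)) :=
        ENNReal.ofReal_le_ofReal hreal
    _ = _ := by
        refine ofReal_integral_eq_lintegral_ofReal ?_ (Filter.Eventually.of_forall hφ0)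
        refine Integrable.of_bound hφ.aestronglyMeasurable 1
          (Filter.Eventually.of_forall fun p => ?_)
        rw [Real.norm_of_nonneg (hφ0 p)]
        exact Finset.prod_le_one (fun k _ => norm_nonneg _) fun k _ => norm_charFun_le_one _

lemma Real.cos_two_pi_mul_le (x : ℝ) :
    Real.cos (2 * Real.pi * x) ≤ 1 - 8 * ‖(x : UnitAddCircle)‖ ^ 2 := by
  rw [UnitAddCircle.norm_eq, sq_abs]
  have h1 : Real.cos (2 * Real.pi * x) = Real.cos (2 * Real.pi * (x - round x)) := by
    rw [mul_sub, mul_comm (2 * Real.pi) (round x : ℝ), Real.cos_sub_int_mul_two_pi]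
  rw [h1]
  have h2 := abs_sub_round x
  have h3 : |2 * Real.pi * (x - round x)| ≤ Real.pi := by
    rw [abs_mul, abs_of_pos (by positivity : 0 < 2 * Real.pi)]
    nlinarith [Real.pi_pos]
  refine (Real.cos_le_one_sub_mul_cos_sq h3).trans (le_of_eq ?_)
  field_simp
  ring

lemma norm_charFun_le_exp (ν : Measure ℝ) [IsProbabilityMeasure ν] (s : ℝ) :
    ‖charFun ν s‖ ≤ Real.exp (-4 * ∫ p : ℝ × ℝ,
      ‖(((p.1 - p.2) / (2 * Real.pi) * s : ℝ) : UnitAddCircle)‖ ^ 2 ∂(ν.prod ν)) := by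
  set J := ∫ p : ℝ × ℝ,
      ‖(((p.1 - p.2) / (2 * Real.pi) * s : ℝ) : UnitAddCircle)‖ ^ 2 ∂(ν.prod ν) with hJ
  have hcosint : Integrable (fun p : ℝ × ℝ => Real.cos (s * (p.1 - p.2))) (ν.prod ν) :=
    Integrable.of_bound (by fun_prop) 1
      (Filter.Eventually.of_forall fun p => Real.abs_cos_le_one _)
  have hexp : ((‖charFun ν s‖ ^ 2 : ℝ) : ℂ) =
      ∫ p : ℝ × ℝ, Complex.exp ((s * (p.1 - p.2) : ℝ) * Complex.I) ∂(ν.prod ν) := by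
    have h : ∀ p : ℝ × ℝ, Complex.exp ((s * (p.1 - p.2) : ℝ) * Complex.I) =
        Complex.exp (s * p.1 * Complex.I) *
          (starRingEnd ℂ) (Complex.exp (s * p.2 * Complex.I)) := by
      intro p
      rw [← Complex.exp_conj, ← Complex.exp_add]
      simp only [map_mul, Complex.conj_I, Complex.conj_ofReal]
      congr 1
      push_cast
      ring
    simp_rw [h]
    rw [integral_prod_mul (fun y : ℝ => Complex.exp (s * y * Complex.I))
      (fun y : ℝ => (starRingEnd ℂ) (Complex.exp (s * y * Complex.I))), integral_conj,
      Complex.mul_conj, Complex.normSq_eq_norm_sq, charFun_apply_real]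
  have hcos : ‖charFun ν s‖ ^ 2 = ∫ p : ℝ × ℝ, Real.cos (s * (p.1 - p.2)) ∂(ν.prod ν) := by
    have hint : Integrable (fun p : ℝ × ℝ => Complex.exp ((s * (p.1 - p.2) : ℝ) * Complex.I))
        (ν.prod ν) :=
      Integrable.of_bound (by fun_prop) 1
        (Filter.Eventually.of_forall fun p => (Complex.norm_exp_ofReal_mul_I _).le)
    have h := congrArg Complex.re hexp
    rw [Complex.ofReal_re] at h
    rw [h]
    have h4 := integral_re hint
    simp only [RCLike.re_to_complex, Complex.exp_ofReal_mul_I_re] at h4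
    exact h4.symm
  have hnormmeas : Continuous fun p : ℝ × ℝ =>
      ‖(((p.1 - p.2) / (2 * Real.pi) * s : ℝ) : UnitAddCircle)‖ ^ 2 := by
    have : Continuous fun p : ℝ × ℝ => (p.1 - p.2) / (2 * Real.pi) * s := by fun_prop
    exact ((AddCircle.continuous_mk' 1).comp this).norm.pow 2
  have hnormint : Integrable (fun p : ℝ × ℝ =>
      ‖(((p.1 - p.2) / (2 * Real.pi) * s : ℝ) : UnitAddCircle)‖ ^ 2) (ν.prod ν) := by
    refine Integrable.of_bound hnormmeas.aestronglyMeasurable 1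
      (Filter.Eventually.of_forall fun p => ?_)
    have h := AddCircle.norm_le_half_period (1 : ℝ) one_ne_zero
      (x := (((p.1 - p.2) / (2 * Real.pi) * s : ℝ) : UnitAddCircle))
    rw [norm_pow, norm_norm]
    norm_num at h
    nlinarith [norm_nonneg (((p.1 - p.2) / (2 * Real.pi) * s : ℝ) : UnitAddCircle)]
  have hle : ‖charFun ν s‖ ^ 2 ≤ 1 - 8 * J := by
    rw [hcos, hJ, ← integral_const_mul]
    calc _ ≤ ∫ p : ℝ × ℝ, (1 - 8 *
          ‖(((p.1 - p.2) / (2 * Real.pi) * s : ℝ) : UnitAddCircle)‖ ^ 2) ∂(ν.prod ν) := by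
          refine integral_mono hcosint ((integrable_const _).sub (hnormint.const_mul _))
            fun p => ?_
          have h := Real.cos_two_pi_mul_le ((p.1 - p.2) / (2 * Real.pi) * s)
          have h5 : 2 * Real.pi * ((p.1 - p.2) / (2 * Real.pi) * s) = s * (p.1 - p.2) := by
            field_simp
          rwa [h5] at h
      _ = _ := by
          rw [integral_sub (integrable_const _) (hnormint.const_mul _)]
          simp
  refine le_of_sq_le_sq ?_ (Real.exp_pos _).le
  calc _ ≤ 1 - 8 * J := hle
    _ ≤ Real.exp (-(8 * J)) := by linarith [Real.add_one_le_exp (-(8 * J))]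
    _ = _ := by rw [← Real.exp_nat_mul]; congr 1; push_cast; ring

lemma prod_norm_charFun_le_integral_exp {n : ℕ} (ν : Measure ℝ) [IsProbabilityMeasure ν] {q : ℝ}
    (hq : q = ((ν.prod ν) {p : ℝ × ℝ | p.1 - p.2 ≠ 0}).toReal) (hq0 : 0 < q) (v : Fin n → ℝ) :
    ∏ k, ‖charFun ν (v k)‖ ≤
      ∫ p : ℝ × ℝ, Real.exp (-(4 * q) * sqDistInt (((p.1 - p.2) / (2 * Real.pi)) • v))
        ∂(ProbabilityTheory.cond (ν.prod ν) {p : ℝ × ℝ | p.1 - p.2 ≠ 0}) := by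
  set S : Set (ℝ × ℝ) := {p | p.1 - p.2 ≠ 0} with hS
  have hS0 : (ν.prod ν) S ≠ 0 := by
    intro h
    rw [h] at hq
    simp at hq
    linarith
  have := ProbabilityTheory.cond_isProbabilityMeasure hS0
  set f : ℝ × ℝ → ℝ := fun p => sqDistInt (((p.1 - p.2) / (2 * Real.pi)) • v) with hf
  have hfc : Continuous f := continuous_sqDistInt.comp (by fun_prop)
  have hfb : ∀ p, ‖f p‖ ≤ n := fun p => by
    rw [Real.norm_of_nonneg (sqDistInt_nonneg _)]; exact sqDistInt_le_card _
  have hfi : ∀ μ : Measure (ℝ × ℝ), IsFiniteMeasure μ → Integrable f μ := fun μ _ =>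
    Integrable.of_bound hfc.aestronglyMeasurable n (Filter.Eventually.of_forall hfb)
  have hcond : ∫ p, f p ∂(ν.prod ν) = q * ∫ p, f p ∂(ProbabilityTheory.cond (ν.prod ν) S) := by
    rw [ProbabilityTheory.cond, integral_smul_measure, ENNReal.toReal_inv, ← hq, smul_eq_mul,
      mul_inv_cancel_left₀ hq0.ne']
    refine (setIntegral_eq_integral_of_forall_compl_eq_zero fun p hp => ?_).symm
    have hp' : p.1 - p.2 = 0 := by simpa [hS] using hp
    simp [hf, hp', sqDistInt_zero]
  have hsum : ∑ k, ∫ p : ℝ × ℝ,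
      ‖(((p.1 - p.2) / (2 * Real.pi) * v k : ℝ) : UnitAddCircle)‖ ^ 2 ∂(ν.prod ν) =
      ∫ p, f p ∂(ν.prod ν) := by
    rw [← integral_finsetSum]
    · rfl
    · intro k _
      have hc : Continuous fun p : ℝ × ℝ =>
          ‖(((p.1 - p.2) / (2 * Real.pi) * v k : ℝ) : UnitAddCircle)‖ ^ 2 :=
        ((AddCircle.continuous_mk' 1).comp (by fun_prop :
          Continuous fun p : ℝ × ℝ => (p.1 - p.2) / (2 * Real.pi) * v k)).norm.pow 2
      refine (hfi (ν.prod ν) inferInstance).mono' hc.aestronglyMeasurable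
        (Filter.Eventually.of_forall fun p => ?_)
      rw [Real.norm_of_nonneg (sq_nonneg _)]
      exact Finset.single_le_sum (f := fun k =>
        ‖(((p.1 - p.2) / (2 * Real.pi) * v k : ℝ) : UnitAddCircle)‖ ^ 2)
        (fun _ _ => sq_nonneg _) (Finset.mem_univ k)
  have hexpc : Continuous fun x : ℝ => Real.exp (-(4 * q) * x) := by fun_prop
  calc ∏ k, ‖charFun ν (v k)‖
      ≤ ∏ k, Real.exp (-4 * ∫ p : ℝ × ℝ,
          ‖(((p.1 - p.2) / (2 * Real.pi) * v k : ℝ) : UnitAddCircle)‖ ^ 2 ∂(ν.prod ν)) :=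
        Finset.prod_le_prod (fun _ _ => norm_nonneg _) fun k _ => norm_charFun_le_exp ν (v k)
    _ = Real.exp (-(4 * q) * ∫ p, f p ∂(ProbabilityTheory.cond (ν.prod ν) S)) := by
        rw [← Real.exp_sum, ← Finset.mul_sum, hsum, hcond]
        congr 1
        ring
    _ ≤ _ := by
        refine ConvexOn.map_integral_le (g := fun x => Real.exp (-(4 * q) * x)) (s := Set.univ)
          ?_ hexpc.continuousOn isClosed_univ (by simp) (hfi _ inferInstance) ?_
        · exact convexOn_exp.comp_linearMap ((-(4 * q)) • (LinearMap.id : ℝ →ₗ[ℝ] ℝ))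
        · refine Integrable.of_bound (hexpc.comp hfc).aestronglyMeasurable 1
            (Filter.Eventually.of_forall fun p => ?_)
          rw [Function.comp_apply, Real.norm_of_nonneg (Real.exp_pos _).le]
          refine Real.exp_le_one_iff.2 ?_
          have : 0 ≤ f p := sqDistInt_nonneg _
          nlinarith

open Matrix in
/-- Average of `exp (-4 q · sqDistInt)` over differences of points of a large cube. -/
lemma lintegral_prod_cond_exp_sqDistInt_le {d n : ℕ} {q l α c T : ℝ} (hq : 0 < q) (hl : 0 < l)
    (hα : 0 < α) (hc : c ≠ 0) (hT : 0 < T) (hlT : l ≤ T * |c|) (A : Matrix (Fin n) (Fin d) ℝ)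
    (hA : (Aᵀ * A).PosDef)
    (H : ∀ t : Fin d → ℝ, (∀ j, |t j| ≤ l) → (∃ k, 1 / 2 ≤ |(A *ᵥ t) k|) →
      α ^ 2 ≤ sqDistInt (A *ᵥ t)) {κ : Measure (Fin d → ℝ)} [IsProbabilityMeasure κ]
    (hκ : κ = ProbabilityTheory.cond volume (Set.Icc 0 fun _ => T)) :
    ∫⁻ p, ENNReal.ofReal (Real.exp (-(4 * q) * sqDistInt (c • (A *ᵥ (p.1 - p.2)))))
        ∂(κ.prod κ) ≤
      ENNReal.ofReal (2 ^ d * (Real.sqrt (Real.pi / q) ^ d / l ^ d *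
        (1 / Real.sqrt (Aᵀ * A).det) + Real.exp (-(4 / 5) * α ^ 2 * q))) := by
  have hc' : 0 < |c| := abs_pos.2 hc
  set l' := l / |c| with hl'
  have hl'0 : 0 < l' := by positivity
  have hl'T : l' ≤ T := (div_le_iff₀ hc').2 hlT
  have hcN : (c • A)ᵀ * (c • A) = (c ^ 2) • (Aᵀ * A) := by
    rw [transpose_smul, Matrix.smul_mul, Matrix.mul_smul, smul_smul, sq]
  have hcA : ((c • A)ᵀ * (c • A)).PosDef := by
    rw [hcN]; exact hA.smul (by positivity)
  have hdet0 : 0 < (Aᵀ * A).det := hA.det_pos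
  have hdet : Real.sqrt ((c • A)ᵀ * (c • A)).det = |c| ^ d * Real.sqrt (Aᵀ * A).det := by
    rw [hcN, det_smul, Fintype.card_fin, Real.sqrt_mul (by positivity), ← pow_mul, mul_comm 2,
      pow_mul, Real.sqrt_sq_eq_abs, abs_pow]
  have H' : ∀ t : Fin d → ℝ, (∀ j, |t j| ≤ l') → (∃ k, 1 / 2 ≤ |((c • A) *ᵥ t) k|) →
      α ^ 2 ≤ sqDistInt ((c • A) *ᵥ t) := by
    intro t ht hk
    rw [smul_mulVec, ← mulVec_smul] at hk ⊢
    refine H _ (fun j => ?_) hk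
    have := ht j
    rw [hl', le_div_iff₀ hc'] at this
    rw [Pi.smul_apply, smul_eq_mul, abs_mul, mul_comm]
    exact this
  set F : (Fin d → ℝ) → ENNReal := fun s =>
    ENNReal.ofReal (Real.exp (-(4 * q) * sqDistInt ((c • A) *ᵥ s))) with hF
  have hFc : Continuous F := by
    have : Continuous fun s : Fin d → ℝ => sqDistInt ((c • A) *ᵥ s) :=
      continuous_sqDistInt.comp (continuous_const.matrix_mulVec continuous_id)
    exact ENNReal.continuous_ofReal.comp (Real.continuous_exp.comp (continuous_const.mul this))
  set R : ℝ := 2 ^ d * (Real.sqrt (Real.pi / q) ^ d / l ^ d *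
        (1 / Real.sqrt (Aᵀ * A).det) + Real.exp (-(4 / 5) * α ^ 2 * q)) with hR
  have hvol : (volume (Set.Icc 0 fun _ => T : Set (Fin d → ℝ))) = ENNReal.ofReal (T ^ d) := by
    simp [Real.volume_Icc_pi, ENNReal.ofReal_pow hT.le]
  have hinner : ∀ t' : Fin d → ℝ, ∫⁻ t, F (t - t') ∂κ ≤ ENNReal.ofReal R := by
    intro t'
    have h1 := setLIntegral_Icc_le_of_small_cubes hFc.measurable hl'0 hl'T
      (setLIntegral_Icc_exp_sqDistInt_le hq hl'0 hα (c • A) hcA H') (-t')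
    have h2 : ∫⁻ t in (Set.Icc 0 fun _ => T : Set (Fin d → ℝ)), F (t - t') =
        ∫⁻ s in Set.Icc (-t') (fun j => (-t') j + T), F s := by
      simp_rw [sub_eq_add_neg]
      rw [setLIntegral_Icc_comp_add_right]
      congr 3
      · simp
      · ext j; simp [add_comm]
    rw [hκ, ProbabilityTheory.cond, lintegral_smul_measure, h2, hvol, smul_eq_mul]
    set I := ∫⁻ s in Set.Icc (-t') (fun j => (-t') j + T), F s
    rw [ENNReal.inv_mul_le_iff (by simp; positivity) ENNReal.ofReal_ne_top]
    have h3 : ENNReal.ofReal (l' ^ d) ≠ 0 := by simp; positivity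
    rw [← ENNReal.mul_le_mul_iff_right h3 ENNReal.ofReal_ne_top]
    refine h1.trans (le_of_eq ?_)
    rw [← ENNReal.ofReal_mul (by positivity), ← ENNReal.ofReal_mul (by positivity),
      ← ENNReal.ofReal_mul (by positivity), hdet, hR, hl', div_pow, mul_pow]
    congr 1
    field_simp
  have hmeas : Measurable fun p : (Fin d → ℝ) × (Fin d → ℝ) => F (p.1 - p.2) :=
    hFc.measurable.comp (measurable_fst.sub measurable_snd)
  calc _ = ∫⁻ p, F (p.1 - p.2) ∂(κ.prod κ) := by simp only [hF, smul_mulVec]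
    _ = ∫⁻ t', ∫⁻ t, F (t - t') ∂κ ∂κ := lintegral_prod_symm' _ hmeas
    _ ≤ ∫⁻ _t', ENNReal.ofReal R ∂κ := lintegral_mono hinner
    _ = ENNReal.ofReal R := by simp

open Matrix in
/-- Bound for the atoms of `∑ k, ω k • A k` under the product measure. -/
lemma pi_fiber_le {d n : ℕ} (ν : Measure ℝ) [IsProbabilityMeasure ν] {q l α : ℝ}
    (hq : q = ((ν.prod ν) {p : ℝ × ℝ | p.1 - p.2 ≠ 0}).toReal) (hq0 : 0 < q) (hl : 0 < l)
    (hα : 0 < α) (A : Matrix (Fin n) (Fin d) ℝ) (hA : (Aᵀ * A).PosDef)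
    (H : ∀ t : Fin d → ℝ, (∀ j, |t j| ≤ l) → (∃ k, 1 / 2 ≤ |(A *ᵥ t) k|) →
      α ^ 2 ≤ sqDistInt (A *ᵥ t)) (x : Fin d → ℝ) :
    (Measure.pi fun _ : Fin n => ν) {ω | ω ᵥ* A = x} ≤
      ENNReal.ofReal (2 ^ d * (Real.sqrt (Real.pi / q) ^ d / l ^ d *
        (1 / Real.sqrt (Aᵀ * A).det) + Real.exp (-(4 / 5) * α ^ 2 * q))) := by
  set S : Set (ℝ × ℝ) := {p | p.1 - p.2 ≠ 0} with hS
  have hS0 : (ν.prod ν) S ≠ 0 := by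
    intro h
    rw [h] at hq
    simp at hq
    linarith
  have hSmeas : MeasurableSet S :=
    (isClosed_eq (by fun_prop : Continuous fun p : ℝ × ℝ => p.1 - p.2)
      continuous_const).measurableSet.compl
  have hprob := ProbabilityTheory.cond_isProbabilityMeasure hS0
  set μ := ProbabilityTheory.cond (ν.prod ν) S with hμ
  set R : ENNReal := ENNReal.ofReal (2 ^ d * (Real.sqrt (Real.pi / q) ^ d / l ^ d *
        (1 / Real.sqrt (Aᵀ * A).det) + Real.exp (-(4 / 5) * α ^ 2 * q))) with hR
  let y : ℝ × ℝ → ℝ := fun p => (p.1 - p.2) / (2 * Real.pi)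
  have hyc : Continuous y := by fun_prop
  let W : ℕ → Set (ℝ × ℝ) := fun N => {p | ((N : ℝ) + 1) * |y p| < l}
  have hWmeas : ∀ N, MeasurableSet (W N) := fun N =>
    (isOpen_lt (continuous_const.mul hyc.abs) continuous_const).measurableSet
  have hμS : ∀ᵐ p ∂μ, p ∈ S := ProbabilityTheory.ae_cond_mem hSmeas
  have hbound : ∀ N : ℕ, (Measure.pi fun _ : Fin n => ν) {ω | ω ᵥ* A = x} ≤ R + μ (W N) := by
    intro N
    set T : ℝ := (N : ℝ) + 1 with hT
    have hT0 : 0 < T := by positivity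
    set κ : Measure (Fin d → ℝ) := ProbabilityTheory.cond volume (Set.Icc 0 fun _ => T) with hκ
    have hvol : (volume (Set.Icc 0 fun _ => T : Set (Fin d → ℝ))) = ENNReal.ofReal (T ^ d) := by
      simp [Real.volume_Icc_pi, ENNReal.ofReal_pow hT0.le]
    have hκp : IsProbabilityMeasure κ :=
      ProbabilityTheory.cond_isProbabilityMeasure_of_finite (by rw [hvol]; simp; positivity)
        (by rw [hvol]; exact ENNReal.ofReal_ne_top)
    let Ψ : (ℝ × ℝ) → ((Fin d → ℝ) × (Fin d → ℝ)) → ℝ := fun p t =>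
      Real.exp (-(4 * q) * sqDistInt (y p • (A *ᵥ (t.1 - t.2))))
    have hΨc : Continuous fun z : (ℝ × ℝ) × ((Fin d → ℝ) × (Fin d → ℝ)) => Ψ z.1 z.2 := by
      have h1 : Continuous fun z : (ℝ × ℝ) × ((Fin d → ℝ) × (Fin d → ℝ)) =>
          y z.1 • (A *ᵥ (z.2.1 - z.2.2)) :=
        (hyc.comp continuous_fst).smul (continuous_const.matrix_mulVec
          ((continuous_fst.comp continuous_snd).sub (continuous_snd.comp continuous_snd)))
      exact Real.continuous_exp.comp (continuous_const.mul (continuous_sqDistInt.comp h1))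
    have hΨ1 : ∀ p t, Ψ p t ≤ 1 := fun p t => by
      refine Real.exp_le_one_iff.2 ?_
      nlinarith [sqDistInt_nonneg (y p • (A *ᵥ (t.1 - t.2)))]
    have hΨint : ∀ t, Integrable (fun p => Ψ p t) μ := fun t =>
      Integrable.of_bound (hΨc.comp (continuous_id.prodMk continuous_const)).aestronglyMeasurable
        1 (Filter.Eventually.of_forall fun p => by
          rw [Real.norm_of_nonneg (Real.exp_pos _).le]; exact hΨ1 p t)
    calc _ ≤ ∫⁻ t, ENNReal.ofReal (∏ k, ‖charFun ν ((A *ᵥ (t.1 - t.2)) k)‖) ∂(κ.prod κ) :=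
          pi_fiber_le_lintegral_prod_norm_charFun ν κ A x
      _ ≤ ∫⁻ t, ∫⁻ p, ENNReal.ofReal (Ψ p t) ∂μ ∂(κ.prod κ) := by
          refine lintegral_mono fun t => ?_
          rw [← ofReal_integral_eq_lintegral_ofReal (hΨint t)
            (Filter.Eventually.of_forall fun p => (Real.exp_pos _).le)]
          exact ENNReal.ofReal_le_ofReal (prod_norm_charFun_le_integral_exp ν hq hq0 _)
      _ = ∫⁻ p, ∫⁻ t, ENNReal.ofReal (Ψ p t) ∂(κ.prod κ) ∂μ := by
          refine lintegral_lintegral_swap ?_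
          exact (ENNReal.measurable_ofReal.comp
            (hΨc.measurable.comp measurable_swap)).aemeasurable
      _ ≤ ∫⁻ p, (R + (W N).indicator 1 p) ∂μ := by
          refine lintegral_mono_ae ?_
          filter_upwards [hμS] with p hp
          by_cases hpW : p ∈ W N
          · rw [Set.indicator_of_mem hpW]
            refine le_trans ?_ le_add_self
            calc _ ≤ ∫⁻ _t, 1 ∂(κ.prod κ) := lintegral_mono fun t => by
                  exact ENNReal.ofReal_le_one.2 (hΨ1 p t)
              _ = _ := by simp
          · refine le_trans ?_ le_self_add
            have hp' : p.1 - p.2 ≠ 0 := hp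
            refine lintegral_prod_cond_exp_sqDistInt_le hq0 hl hα ?_ hT0 (not_lt.1 hpW) A hA H hκ
            exact div_ne_zero hp' (by positivity)
      _ = R + μ (W N) := by
          rw [lintegral_add_left measurable_const, lintegral_indicator_one (hWmeas N)]
          simp
  have hanti : Antitone W := by
    intro M N hMN p hp
    have hp' : ((N : ℝ) + 1) * |y p| < l := hp
    change ((M : ℝ) + 1) * |y p| < l
    refine lt_of_le_of_lt ?_ hp'
    gcongr
  have hlim : Filter.Tendsto (fun N => μ (W N)) Filter.atTop (nhds 0) := by
    have h1 := tendsto_measure_iInter_atTop (μ := μ) (fun N => (hWmeas N).nullMeasurableSet) hanti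
      ⟨0, measure_ne_top _ _⟩
    have h2 : μ (⋂ N, W N) = 0 := by
      rw [measure_eq_zero_iff_ae_notMem]
      filter_upwards [hμS] with p hp' hp
      have hy : 0 < |y p| := abs_pos.2 (div_ne_zero hp' (by positivity))
      obtain ⟨N, hN⟩ := exists_nat_gt (l / |y p|)
      have h3 : ((N : ℝ) + 1) * |y p| < l := Set.mem_iInter.1 hp N
      rw [div_lt_iff₀ hy] at hN
      linarith
    rwa [h2] at h1
  have hlim' : Filter.Tendsto (fun N => R + μ (W N)) Filter.atTop (nhds R) := by
    simpa using hlim.const_add R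
  exact ge_of_tendsto' hlim' hbound

theorem stmt_3 :
    ∃ c₁ c₂ : ℝ, 0 < c₁ ∧ 0 < c₂ ∧
      ∀ (d n : ℕ), 0 < d →
      ∀ (ν : Measure ℝ), IsProbabilityMeasure ν →
      ∀ q : ℝ, q = ((ν.prod ν) {p : ℝ × ℝ | p.1 - p.2 ≠ 0}).toReal → 0 < q →
      ∀ (a : Fin n → EuclideanSpace ℝ (Fin d)),
      (covMat a).PosDef →
      ∀ D α : ℝ, 0 < D → 0 < α →
      (∀ (m : Fin n → ℤ) (t : EuclideanSpace ℝ (Fin d)),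
        ‖t‖ ≤ D → (∃ k, (1 / 2 : ℝ) ≤ |⟪t, a k⟫|) →
        α ^ 2 ≤ ∑ k, (⟪t, a k⟫ - m k) ^ 2) →
      (⨆ x : EuclideanSpace ℝ (Fin d), (sumLaw ν a {x}).toReal) ≤
        c₁ ^ d * ((Real.sqrt d / (D * Real.sqrt q)) ^ d
            * (1 / Real.sqrt (covMat a).det)
          + Real.exp (-c₂ * α ^ 2 * q)) := by
  refine ⟨4, 4 / 5, by norm_num, by norm_num, ?_⟩
  intro d n hd ν hν q hq hq0 a ha D α hD hα H
  set A : Matrix (Fin n) (Fin d) ℝ := Matrix.of fun k j => a k j with hA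
  have hcov : covMat a = A.transpose * A := by
    ext i j
    simp [covMat, hA, Matrix.mul_apply]
  have hd0 : 0 < Real.sqrt d := Real.sqrt_pos.2 (by exact_mod_cast hd)
  have hdot : ∀ (t : Fin d → ℝ) k, ⟪WithLp.toLp 2 t, a k⟫ = (A.mulVec t) k := by
    intro t k
    simp [hA, Matrix.mulVec, dotProduct, PiLp.inner_apply]
  have H' : ∀ t : Fin d → ℝ, (∀ j, |t j| ≤ D / Real.sqrt d) → (∃ k, 1 / 2 ≤ |(A.mulVec t) k|) →
      α ^ 2 ≤ sqDistInt (A.mulVec t) := by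
    intro t ht hk
    have h := H (fun k => round ((A.mulVec t) k)) (WithLp.toLp 2 t) ?_
      (by simpa only [hdot] using hk)
    · rw [sqDistInt_eq_sum_round]
      simpa only [hdot] using h
    · rw [EuclideanSpace.norm_eq]
      refine Real.sqrt_le_iff.2 ⟨hD.le, ?_⟩
      calc ∑ j, ‖t j‖ ^ 2 ≤ ∑ _j : Fin d, (D / Real.sqrt d) ^ 2 := by
            refine Finset.sum_le_sum fun j _ => ?_
            exact pow_le_pow_left₀ (norm_nonneg _) (ht j) 2
        _ = D ^ 2 := by
            rw [Finset.sum_const, Finset.card_univ, Fintype.card_fin, nsmul_eq_mul, div_pow,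
              Real.sq_sqrt (Nat.cast_nonneg d)]
            have : (d : ℝ) ≠ 0 := by positivity
            field_simp
  have hdet : 0 < (covMat a).det := ha.det_pos
  have hpi : Real.sqrt Real.pi ≤ 2 := by
    rw [Real.sqrt_le_left (by norm_num)]
    linarith [Real.pi_le_four]
  refine ciSup_le fun x => ?_
  have hmap : sumLaw ν a {x} =
      (Measure.pi fun _ : Fin n => ν) {ω | Matrix.vecMul ω A = WithLp.ofLp x} := by
    rw [sumLaw, Measure.map_apply (by fun_prop) (measurableSet_singleton x)]
    congr 1
    ext ω
    simp only [Set.mem_preimage, Set.mem_singleton_iff, Set.mem_ofPred_eq]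
    rw [← (WithLp.ofLp_injective 2).eq_iff]
    have : WithLp.ofLp (∑ k, ω k • a k) = Matrix.vecMul ω A := by
      ext j
      simp [hA, Matrix.vecMul, dotProduct]
    rw [this]
  rw [hmap]
  have hmain := pi_fiber_le ν hq hq0 (div_pos hD hd0) hα A (hcov ▸ ha) H' (WithLp.ofLp x)
  rw [← hcov] at hmain
  refine (ENNReal.toReal_le_of_le_ofReal (by positivity) hmain).trans ?_
  have e1 : Real.sqrt (Real.pi / q) ^ d / (D / Real.sqrt d) ^ d =
      Real.sqrt Real.pi ^ d * (Real.sqrt d / (D * Real.sqrt q)) ^ d := by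
    rw [← div_pow, ← mul_pow, Real.sqrt_div Real.pi_pos.le]
    congr 1
    field_simp
  have e2 : Real.sqrt Real.pi ^ d ≤ 2 ^ d := pow_le_pow_left₀ (Real.sqrt_nonneg _) hpi d
  have e3 : (1 : ℝ) ≤ 2 ^ d := one_le_pow₀ (by norm_num)
  set B := Real.sqrt d / (D * Real.sqrt q)
  have hB : 0 ≤ B ^ d * (1 / Real.sqrt (covMat a).det) := by positivity
  have hle : Real.sqrt Real.pi ^ d * B ^ d * (1 / Real.sqrt (covMat a).det) ≤
      2 ^ d * (B ^ d * (1 / Real.sqrt (covMat a).det)) := by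
    rw [mul_assoc]
    exact mul_le_mul_of_nonneg_right e2 hB
  rw [e1, show (4 : ℝ) ^ d = 2 ^ d * 2 ^ d by rw [← mul_pow]; norm_num, mul_assoc (2 ^ d : ℝ)]
  refine mul_le_mul_of_nonneg_left ?_ (by positivity)
  rw [mul_add]
  exact add_le_add hle (le_mul_of_one_le_left (Real.exp_pos _).le e3)
end

section
/- Let X, X₁, …, Xₙ be i.i.d. real-valued random variables with M(1) > 0, and let a = (a₁, …, aₙ) with aₖ ∈ ℝ^d be such that 𝑁 = Σₖ aₖaₖᵀ is positive definite. Let α > 0, D > 0, γ ∈ (0,1), and suppose that (Σₖ(⟨t,aₖ⟩ − mₖ)²)^{1/2} ≥ min{γ‖t·a‖, α} for all integers m₁, …, mₙ and all t ∈ ℝ^d with ‖t‖ ≤ D. Then there exist absolute constants c₁, c₂ > 0 such that Q(F_a, d/D) ≤ c₁^d ( (√d/(D γ √M(1)))^d (det 𝑁)^{-1/2} + exp(−c₂ α² M(1)) ). -/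
open MeasureTheory
open scoped RealInnerProductSpace

theorem eight_mul_sq_sub_round_le (x : ℝ) :
    8 * (x - round x) ^ 2 ≤ 1 - Real.cos (2 * Real.pi * x) := by
  have hpi := Real.pi_pos
  have hr := abs_sub_round x
  have hcos : Real.cos (2 * Real.pi * x) = Real.cos (2 * Real.pi * (x - round x)) := by
    rw [← Real.cos_sub_int_mul_two_pi _ (round x)]
    ring_nf
  have h := Real.cos_le_one_sub_mul_cos_sq (x := 2 * Real.pi * (x - round x)) (by
    rw [abs_mul, abs_of_pos (by positivity)]
    nlinarith)
  have h2 : 2 / Real.pi ^ 2 * (2 * Real.pi * (x - round x)) ^ 2 = 8 * (x - round x) ^ 2 := by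
    field_simp
    ring
  rw [hcos]
  linarith

theorem one_sub_cos_sub_le (a b : ℝ) :
    1 - Real.cos (a - b) ≤ 2 * (1 - Real.cos a) + 2 * (1 - Real.cos b) := by
  rw [Real.cos_sub]
  nlinarith [sq_nonneg (Real.cos a + Real.cos b - 2), sq_nonneg (Real.sin a + Real.sin b),
    Real.sin_sq_add_cos_sq a, Real.sin_sq_add_cos_sq b]

section InnerProductSpace

variable {V : Type*} [NormedAddCommGroup V] [InnerProductSpace ℝ V] [FiniteDimensional ℝ V]
  [MeasurableSpace V] [BorelSpace V]

theorem integrable_exp_neg_mul_norm_sq {b : ℝ} (hb : 0 < b) :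
    Integrable (fun v : V => Real.exp (-b * ‖v‖ ^ 2)) := by
  have h := (GaussianFourier.integrable_cexp_neg_mul_sq_norm_add (V := V) (b := (b : ℂ))
    (by simpa using hb) 0 0).re
  refine h.congr (Filter.Eventually.of_forall fun v => ?_)
  simp only [zero_mul, add_zero, RCLike.re_to_complex]
  rw [← Complex.ofReal_pow, ← Complex.ofReal_neg, ← Complex.ofReal_mul, Complex.exp_ofReal_re]

theorem lintegral_exp_neg_mul_norm_sq {b : ℝ} (hb : 0 < b) :
    ∫⁻ v : V, ENNReal.ofReal (Real.exp (-b * ‖v‖ ^ 2)) =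
      ENNReal.ofReal ((Real.pi / b) ^ (Module.finrank ℝ V / 2 : ℝ)) := by
  rw [← GaussianFourier.integral_rexp_neg_mul_sq_norm (V := V) hb,
    ofReal_integral_eq_lintegral_ofReal (integrable_exp_neg_mul_norm_sq hb)
      (Filter.Eventually.of_forall fun v => (Real.exp_pos _).le)]

/-- Gaussian regularization: small ball probabilities are controlled by the Gaussian average of
the characteristic function. -/
theorem measureReal_closedBall_le_integral_charFun (μ : Measure V) [IsProbabilityMeasure μ]
    {b : ℝ} (hb : 0 < b) (x : V) (r : ℝ) :
    μ.real (Metric.closedBall x r) ≤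
      Real.exp (Real.pi ^ 2 * r ^ 2 / b) * ((b / Real.pi) ^ (Module.finrank ℝ V / 2 : ℝ) *
        ∫ t : V, Real.exp (-b * ‖t‖ ^ 2) * ‖charFun μ ((2 * Real.pi) • t)‖) := by
  have hpi := Real.pi_pos
  set s : ℝ := (Real.pi / b) ^ (Module.finrank ℝ V / 2 : ℝ) with hs
  have hs0 : 0 < s := by positivity
  have hsinv : (b / Real.pi) ^ (Module.finrank ℝ V / 2 : ℝ) = s⁻¹ := by
    rw [hs, ← Real.inv_rpow (by positivity), inv_div]
  set G : V → V → ℂ := fun y t =>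
    Complex.exp (-(b : ℂ) * ‖t‖ ^ 2 + (2 * Real.pi * Complex.I) * ((⟪y - x, t⟫ : ℝ) : ℂ)) with hG
  have hnorm : ∀ y t, ‖G y t‖ = Real.exp (-b * ‖t‖ ^ 2) := by
    intro y t
    rw [hG, Complex.norm_exp]
    congr 1
    simp [← Complex.ofReal_pow]
  have hGint : ∀ y, ∫ t, G y t = ((s * Real.exp (-(Real.pi ^ 2 * ‖y - x‖ ^ 2 / b)) : ℝ) : ℂ) := by
    intro y
    have h := GaussianFourier.integral_cexp_neg_mul_sq_norm_add (V := V) (b := (b : ℂ))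
      (by simpa using hb) (2 * Real.pi * Complex.I) (y - x)
    rw [hG, h, hs]
    push_cast
    rw [Complex.ofReal_cpow (by positivity)]
    push_cast
    congr 2
    have : (b : ℂ) ≠ 0 := by exact_mod_cast hb.ne'
    field_simp
    rw [Complex.I_sq]
    ring
  have hGi : Integrable (Function.uncurry G) (μ.prod volume) := by
    have h1 : Integrable (fun p : V × V => Real.exp (-b * ‖p.2‖ ^ 2)) (μ.prod volume) :=
      (integrable_exp_neg_mul_norm_sq hb).comp_snd μ
    refine h1.mono' ?_ (Filter.Eventually.of_forall fun p => (hnorm p.1 p.2).le)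
    refine Continuous.aestronglyMeasurable ?_
    simp only [hG, Function.uncurry_def]
    fun_prop
  have hswap : ∫ y, (∫ t, G y t) ∂μ = ∫ t, (∫ y, G y t ∂μ) := integral_integral_swap hGi
  have hchar : ∀ t, ‖∫ y, G y t ∂μ‖ =
      Real.exp (-b * ‖t‖ ^ 2) * ‖charFun μ ((2 * Real.pi) • t)‖ := by
    intro t
    have : ∀ y, G y t = G 0 t * Complex.exp ((⟪y, (2 * Real.pi) • t⟫ : ℝ) * Complex.I) := by
      intro y
      simp only [hG]
      rw [← Complex.exp_add]
      congr 1
      simp only [inner_sub_left, inner_smul_right, inner_zero_left]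
      push_cast
      ring
    rw [integral_congr_ae (Filter.Eventually.of_forall this), integral_const_mul,
      norm_mul, hnorm, charFun_apply]
  have hmain : ∫ y, s * Real.exp (-(Real.pi ^ 2 * ‖y - x‖ ^ 2 / b)) ∂μ ≤
      ∫ t : V, Real.exp (-b * ‖t‖ ^ 2) * ‖charFun μ ((2 * Real.pi) • t)‖ := by
    refine (Real.le_norm_self _).trans ?_
    rw [← Complex.norm_real, ← integral_complex_ofReal]
    simp_rw [← hGint, ← hchar]
    rw [hswap]
    exact norm_integral_le_integral_norm _
  have hind : μ.real (Metric.closedBall x r) ≤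
      ∫ y, Real.exp (Real.pi ^ 2 * r ^ 2 / b) *
        Real.exp (-(Real.pi ^ 2 * ‖y - x‖ ^ 2 / b)) ∂μ := by
    rw [← integral_indicator_one Metric.isClosed_closedBall.measurableSet]
    refine integral_mono_of_nonneg (Filter.Eventually.of_forall fun y => ?_) ?_
      (Filter.Eventually.of_forall fun y => ?_)
    · exact Set.indicator_nonneg (fun _ _ => zero_le_one) y
    · refine Integrable.const_mul ?_ _
      refine Integrable.mono' (integrable_const (1 : ℝ)) ?_ (Filter.Eventually.of_forall fun y => ?_)
      · exact Continuous.aestronglyMeasurable (by fun_prop)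
      · rw [Real.norm_eq_abs, Real.abs_exp, Real.exp_le_one_iff, Left.neg_nonpos_iff]
        positivity
    · by_cases hz : y ∈ Metric.closedBall x r
      · rw [Set.indicator_of_mem hz, Pi.one_apply]
        dsimp only
        rw [← Real.exp_add]
        refine Real.one_le_exp ?_
        rw [mem_closedBall_iff_norm] at hz
        have : ‖y - x‖ ^ 2 ≤ r ^ 2 := pow_le_pow_left₀ (norm_nonneg _) hz 2
        have : Real.pi ^ 2 * ‖y - x‖ ^ 2 / b ≤ Real.pi ^ 2 * r ^ 2 / b := by gcongr
        linarith
      · rw [Set.indicator_of_notMem hz]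
        positivity
  rw [hsinv]
  rw [integral_const_mul] at hind hmain
  refine hind.trans ?_
  gcongr
  rw [le_inv_mul_iff₀ hs0]
  exact hmain

theorem mul_volume_closedBall_le_setIntegral {b ρ : ℝ} (hb : 0 ≤ b) (u : V) :
    Real.exp (-b * ‖u‖ ^ 2) * volume.real (Metric.closedBall (0 : V) ρ) ≤
      Real.exp (b * ρ ^ 2) * ∫ v in Metric.closedBall (0 : V) ρ, Real.exp (-b * ‖u - v‖ ^ 2) := by
  set K := Metric.closedBall (0 : V) ρ with hK
  have hKc : IsCompact K := isCompact_closedBall _ _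
  have hi : ∀ f : V → ℝ, Continuous f → IntegrableOn f K := fun f hf =>
    hf.continuousOn.integrableOn_compact hKc
  have hodd : ∫ v in K, ⟪u, v⟫ = 0 := by
    have h := integral_neg_eq_self (K.indicator fun v => ⟪u, v⟫) (volume : Measure V)
    have h2 : (fun v => K.indicator (fun v => ⟪u, v⟫) (-v)) =
        fun v => -K.indicator (fun v => ⟪u, v⟫) v := by
      funext v
      by_cases hv : v ∈ K
      · have hv' : -v ∈ K := by simpa [hK] using hv
        simp [hv, hv']
      · have hv' : -v ∉ K := by simpa [hK] using hv
        simp [hv, hv']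
    rw [h2, integral_neg, integral_indicator hKc.measurableSet] at h
    linarith
  have hle : ∫ v in K, Real.exp (-b * ‖u‖ ^ 2) * (1 + 2 * b * ⟪u, v⟫) ≤
      ∫ v in K, Real.exp (b * ρ ^ 2) * Real.exp (-b * ‖u - v‖ ^ 2) := by
    refine setIntegral_mono_on (hi _ (by fun_prop)) (hi _ (by fun_prop)) hKc.measurableSet
      fun v hv => ?_
    have hv' : ‖v‖ ≤ ρ := by simpa [hK] using hv
    have hv2 : ‖v‖ ^ 2 ≤ ρ ^ 2 := pow_le_pow_left₀ (norm_nonneg _) hv' 2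
    have h1 : 1 + 2 * b * ⟪u, v⟫ ≤ Real.exp (2 * b * ⟪u, v⟫) := by
      linarith [Real.add_one_le_exp (2 * b * ⟪u, v⟫)]
    calc _ ≤ Real.exp (-b * ‖u‖ ^ 2) * Real.exp (2 * b * ⟪u, v⟫) := by gcongr
      _ ≤ _ := by
        rw [← Real.exp_add, ← Real.exp_add, Real.exp_le_exp, norm_sub_sq_real]
        nlinarith
  rw [integral_const_mul, integral_const_mul,
    integral_add (hi _ continuous_const) (hi _ (by fun_prop)), integral_const_mul, hodd] at hle
  simpa using hle

/-- A Gaussian integral is controlled by the largest local integral over balls of radius `ρ`. -/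
theorem volume_closedBall_mul_lintegral_le {b ρ : ℝ} (hb : 0 < b) {g : V → ENNReal}
    (hg : Measurable g) {J : ENNReal} (hJ : ∀ y, ∫⁻ u in Metric.closedBall y ρ, g u ≤ J) :
    volume (Metric.closedBall (0 : V) ρ) *
        ∫⁻ u : V, ENNReal.ofReal (Real.exp (-b * ‖u‖ ^ 2)) * g u ≤
      ENNReal.ofReal (Real.exp (b * ρ ^ 2)) *
        (ENNReal.ofReal ((Real.pi / b) ^ (Module.finrank ℝ V / 2 : ℝ)) * J) := by
  set K := Metric.closedBall (0 : V) ρ with hK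
  have hKm : MeasurableSet K := Metric.isClosed_closedBall.measurableSet
  have hKfin : volume K ≠ ⊤ := (isCompact_closedBall (0 : V) ρ).measure_lt_top.ne
  set w : V → ENNReal := fun u => ENNReal.ofReal (Real.exp (-b * ‖u‖ ^ 2)) with hw
  have hwm : Measurable w := by fun_prop
  have hpt : ∀ u, volume K * w u ≤
      ENNReal.ofReal (Real.exp (b * ρ ^ 2)) * ∫⁻ v in K, w (u - v) := by
    intro u
    have h := mul_volume_closedBall_le_setIntegral (ρ := ρ) hb.le u
    rw [← ofReal_integral_eq_lintegral_ofReal, ← ENNReal.ofReal_mul (Real.exp_pos _).le,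
      ← ENNReal.ofReal_toReal hKfin, ← ENNReal.ofReal_mul ENNReal.toReal_nonneg]
    · refine ENNReal.ofReal_le_ofReal ?_
      rw [mul_comm]
      exact h
    · exact (Continuous.continuousOn (by fun_prop)).integrableOn_compact
        (isCompact_closedBall _ _)
    · exact Filter.Eventually.of_forall fun v => (Real.exp_pos _).le
  have hshift : ∀ v, ∫⁻ u, w (u - v) * g u = ∫⁻ y, w y * g (y + v) := by
    intro v
    rw [← lintegral_add_right_eq_self _ v]
    simp
  have hball : ∀ y, ∫⁻ v in K, g (y + v) ≤ J := by
    intro y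
    refine le_trans (le_of_eq ?_) (hJ y)
    rw [← lintegral_indicator hKm, ← lintegral_indicator Metric.isClosed_closedBall.measurableSet,
      ← lintegral_add_left_eq_self ((Metric.closedBall y ρ).indicator g) y]
    refine lintegral_congr fun v => ?_
    by_cases hv : v ∈ K
    · have hv' : y + v ∈ Metric.closedBall y ρ := by simpa [hK] using hv
      simp [hv, hv']
    · have hv' : y + v ∉ Metric.closedBall y ρ := by simpa [hK] using hv
      simp [hv, hv']
  calc volume K * ∫⁻ u, w u * g u
      = ∫⁻ u, volume K * w u * g u := by
        rw [← lintegral_const_mul _ (by fun_prop)]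
        simp_rw [mul_assoc]
    _ ≤ ∫⁻ u, ENNReal.ofReal (Real.exp (b * ρ ^ 2)) * ∫⁻ v in K, w (u - v) * g u := by
        refine lintegral_mono fun u => ?_
        rw [lintegral_mul_const _ (by fun_prop), ← mul_assoc]
        exact mul_le_mul_left (hpt u) _
    _ = ENNReal.ofReal (Real.exp (b * ρ ^ 2)) * ∫⁻ u, ∫⁻ v in K, w (u - v) * g u := by
        rw [lintegral_const_mul' _ _ ENNReal.ofReal_ne_top]
    _ = ENNReal.ofReal (Real.exp (b * ρ ^ 2)) * ∫⁻ v in K, ∫⁻ u, w (u - v) * g u := by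
        rw [lintegral_lintegral_swap]
        exact Measurable.aemeasurable (by simp only [Function.uncurry_def]; fun_prop)
    _ = ENNReal.ofReal (Real.exp (b * ρ ^ 2)) * ∫⁻ v in K, ∫⁻ y, w y * g (y + v) := by
        simp_rw [hshift]
    _ = ENNReal.ofReal (Real.exp (b * ρ ^ 2)) * ∫⁻ y, ∫⁻ v in K, w y * g (y + v) := by
        rw [lintegral_lintegral_swap]
        exact Measurable.aemeasurable (by simp only [Function.uncurry_def]; fun_prop)
    _ ≤ ENNReal.ofReal (Real.exp (b * ρ ^ 2)) * ∫⁻ y, w y * J := by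
        gcongr with y
        rw [lintegral_const_mul _ (by fun_prop)]
        gcongr
        exact hball y
    _ = _ := by
        rw [lintegral_mul_const _ hwm, lintegral_exp_neg_mul_norm_sq hb]

/-- If `H` is quasi-subadditive, the local integrals of `exp (-H / 2)` are
controlled by the integral of `exp (-H / 8)` over a ball centred at the origin. -/
theorem setLIntegral_exp_neg_half_le {H : V → ℝ} (hHc : Continuous H)
    (hH : ∀ u v, H (u - v) ≤ 2 * H u + 2 * H v) {ρ : ℝ} (hρ : 0 ≤ ρ) (y : V) :
    ∫⁻ u in Metric.closedBall y ρ, ENNReal.ofReal (Real.exp (-(H u / 2))) ≤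
      ∫⁻ u in Metric.closedBall (0 : V) (2 * ρ), ENNReal.ofReal (Real.exp (-(H u / 8))) := by
  obtain ⟨u₀, hu₀, hmin⟩ := (isCompact_closedBall y ρ).exists_isMinOn
    ⟨y, Metric.mem_closedBall_self hρ⟩ hHc.continuousOn
  rw [← lintegral_indicator Metric.isClosed_closedBall.measurableSet,
    ← lintegral_indicator Metric.isClosed_closedBall.measurableSet,
    ← lintegral_sub_right_eq_self ((Metric.closedBall (0 : V) (2 * ρ)).indicator _) u₀]
  refine lintegral_mono fun u => ?_
  by_cases hu : u ∈ Metric.closedBall y ρ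
  · have hu' : u - u₀ ∈ Metric.closedBall (0 : V) (2 * ρ) := by
      rw [mem_closedBall_zero_iff, ← dist_eq_norm]
      have := dist_triangle_right u u₀ y
      rw [Metric.mem_closedBall] at hu hu₀
      linarith
    rw [Set.indicator_of_mem hu, Set.indicator_of_mem hu']
    refine ENNReal.ofReal_le_ofReal (Real.exp_le_exp.2 ?_)
    have h1 := hH u u₀
    have h2 : H u₀ ≤ H u := hmin hu
    linarith
  · rw [Set.indicator_of_notMem hu]
    exact zero_le

end InnerProductSpace

theorem sum_inner_sq_eq_dotProduct_covMat {d n : ℕ} (a : Fin n → EuclideanSpace ℝ (Fin d))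
    (t : EuclideanSpace ℝ (Fin d)) :
    ∑ k, ⟪t, a k⟫ ^ 2 = t.ofLp ⬝ᵥ (covMat a).mulVec t.ofLp := by
  simp only [covMat, dotProduct, Matrix.mulVec, Matrix.of_apply, PiLp.inner_apply,
    RCLike.inner_apply, conj_trivial, Finset.mul_sum, Finset.sum_mul, sq]
  rw [Finset.sum_comm]
  refine Finset.sum_congr rfl fun i _ => ?_
  rw [Finset.sum_comm]
  refine Finset.sum_congr rfl fun j _ => Finset.sum_congr rfl fun k _ => ?_
  ring

open scoped MatrixOrder Matrix.Norms.L2Operator in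
theorem exists_linearMap_norm_sq_eq {d n : ℕ} (a : Fin n → EuclideanSpace ℝ (Fin d))
    (ha : (covMat a).PosDef) :
    ∃ f : EuclideanSpace ℝ (Fin d) →ₗ[ℝ] EuclideanSpace ℝ (Fin d),
      (∀ t, ‖f t‖ ^ 2 = ∑ k, ⟪t, a k⟫ ^ 2) ∧ LinearMap.det f ^ 2 = (covMat a).det := by
  obtain ⟨B, hB⟩ := CStarAlgebra.nonneg_iff_eq_star_mul_self.mp ha.posSemidef.nonneg
  rw [Matrix.star_eq_conjTranspose, Matrix.conjTranspose_eq_transpose_of_trivial] at hB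
  refine ⟨Matrix.toEuclideanLin B, fun t => ?_, ?_⟩
  · rw [sum_inner_sq_eq_dotProduct_covMat, hB, EuclideanSpace.real_norm_sq_eq,
      ← Matrix.mulVec_mulVec, Matrix.dotProduct_mulVec, Matrix.vecMul_transpose]
    simp [dotProduct, sq, Matrix.toLpLin_apply]
  · rw [Matrix.toEuclideanLin, Matrix.toLpLin_eq_toLin, LinearMap.det_toLin, hB, Matrix.det_mul,
      Matrix.det_transpose, sq]

theorem lintegral_exp_neg_mul_sum_inner_sq {d n : ℕ} (a : Fin n → EuclideanSpace ℝ (Fin d))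
    (ha : (covMat a).PosDef) {c : ℝ} (hc : 0 < c) :
    ∫⁻ t : EuclideanSpace ℝ (Fin d), ENNReal.ofReal (Real.exp (-c * ∑ k, ⟪t, a k⟫ ^ 2)) =
      ENNReal.ofReal ((Real.pi / c) ^ (d / 2 : ℝ) * (1 / Real.sqrt (covMat a).det)) := by
  obtain ⟨f, hf, hdet⟩ := exists_linearMap_norm_sq_eq a ha
  have hdet0 : LinearMap.det f ≠ 0 := by
    intro h
    have := ha.det_pos
    rw [← hdet, h] at this
    simp at this
  have hfm : Measurable f := f.continuous_of_finiteDimensional.measurable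
  simp_rw [← hf]
  rw [← lintegral_map (f := fun v : EuclideanSpace ℝ (Fin d) =>
      ENNReal.ofReal (Real.exp (-c * ‖v‖ ^ 2))) (by fun_prop) hfm,
    Measure.map_linearMap_addHaar_eq_smul_addHaar _ hdet0, lintegral_smul_measure,
    lintegral_exp_neg_mul_norm_sq hc, smul_eq_mul, ← ENNReal.ofReal_mul (abs_nonneg _), ← hdet,
    Real.sqrt_sq_eq_abs, abs_inv, finrank_euclideanSpace_fin, mul_comm, one_div]

theorem ofReal_le_volume_closedBall (d : ℕ) {ρ : ℝ} (hρ : 0 ≤ ρ) :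
    ENNReal.ofReal ((2 * ρ / Real.sqrt d) ^ d) ≤
      volume (Metric.closedBall (0 : EuclideanSpace ℝ (Fin d)) ρ) := by
  set r : ℝ := ρ / Real.sqrt d with hr
  have hr0 : 0 ≤ r := by positivity
  have hmp := EuclideanSpace.volume_preserving_symm_measurableEquiv_toLp (Fin d)
  have hvol : volume (Set.Icc (fun _ : Fin d => -r) (fun _ => r)) =
      ENNReal.ofReal ((2 * ρ / Real.sqrt d) ^ d) := by
    rw [Real.volume_Icc_pi, Finset.prod_const, Finset.card_univ, Fintype.card_fin,
      ENNReal.ofReal_pow (by positivity)]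
    congr 2
    rw [hr]
    ring
  rw [← hvol, ← hmp.measure_preimage measurableSet_Icc.nullMeasurableSet]
  refine measure_mono fun t ht => ?_
  rw [mem_closedBall_zero_iff]
  refine abs_le_of_sq_le_sq' ?_ hρ |>.2
  rw [EuclideanSpace.real_norm_sq_eq]
  have hi : ∀ i ∈ Finset.univ, t.ofLp i ^ 2 ≤ r ^ 2 := fun i _ =>
    sq_le_sq' (ht.1 i) (ht.2 i)
  refine (Finset.sum_le_sum hi).trans ?_
  rw [Finset.sum_const, Finset.card_univ, Fintype.card_fin, nsmul_eq_mul, hr, div_pow,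
    Real.sq_sqrt (Nat.cast_nonneg d)]
  rcases Nat.eq_zero_or_pos d with rfl | hd
  · simpa using sq_nonneg ρ
  · have : (d : ℝ) ≠ 0 := by positivity
    rw [mul_div_cancel₀ _ this]

theorem isProbabilityMeasure_sumLaw {d n : ℕ} (ν : Measure ℝ) [IsProbabilityMeasure ν]
    (a : Fin n → EuclideanSpace ℝ (Fin d)) : IsProbabilityMeasure (sumLaw ν a) :=
  Measure.isProbabilityMeasure_map (Continuous.aemeasurable (by fun_prop))

theorem charFun_sumLaw {d n : ℕ} (ν : Measure ℝ) [IsProbabilityMeasure ν]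
    (a : Fin n → EuclideanSpace ℝ (Fin d)) (t : EuclideanSpace ℝ (Fin d)) :
    charFun (sumLaw ν a) t = ∏ k, charFun ν ⟪t, a k⟫ := by
  rw [charFun_apply, sumLaw, integral_map (Continuous.aemeasurable (by fun_prop))
    (Continuous.aestronglyMeasurable (by fun_prop))]
  simp_rw [charFun_apply_real]
  rw [← integral_fintype_prod_eq_prod]
  refine integral_congr_ae (Filter.Eventually.of_forall fun ω => ?_)
  dsimp only
  rw [← Complex.exp_sum]
  congr 1
  rw [sum_inner]
  push_cast
  rw [Finset.sum_mul]
  refine Finset.sum_congr rfl fun k _ => ?_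
  rw [real_inner_smul_left, real_inner_comm]
  push_cast
  ring

theorem norm_charFun_sq_eq_integral_cos (ν : Measure ℝ) [IsProbabilityMeasure ν] (s : ℝ) :
    ‖charFun ν s‖ ^ 2 = ∫ p : ℝ × ℝ, Real.cos (s * (p.1 - p.2)) ∂(ν.prod ν) := by
  have h : ((‖charFun ν s‖ ^ 2 : ℝ) : ℂ) =
      ∫ p : ℝ × ℝ, Complex.exp (s * (p.1 - p.2) * Complex.I) ∂(ν.prod ν) := by
    push_cast
    rw [← Complex.mul_conj', ← charFun_neg, charFun_apply_real, charFun_apply_real,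
      ← integral_prod_mul]
    refine integral_congr_ae (Filter.Eventually.of_forall fun p => ?_)
    dsimp only
    rw [← Complex.exp_add]
    congr 1
    push_cast
    ring
  have hi : Integrable (fun p : ℝ × ℝ => Complex.exp (s * (p.1 - p.2) * Complex.I))
      (ν.prod ν) := by
    refine Integrable.mono' (integrable_const (1 : ℝ))
      (Continuous.aestronglyMeasurable (by fun_prop)) (Filter.Eventually.of_forall fun p => ?_)
    rw [← Complex.ofReal_sub, ← Complex.ofReal_mul, Complex.norm_exp_ofReal_mul_I]
  have h2 := congrArg Complex.re h
  rw [Complex.ofReal_re, ← RCLike.re_to_complex, ← integral_re hi] at h2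
  rw [h2]
  refine integral_congr_ae (Filter.Eventually.of_forall fun p => ?_)
  dsimp only
  rw [← Complex.ofReal_sub, ← Complex.ofReal_mul, RCLike.re_to_complex, Complex.exp_ofReal_mul_I_re]

theorem norm_charFun_sumLaw_le {d n : ℕ} (ν : Measure ℝ) [IsProbabilityMeasure ν]
    (a : Fin n → EuclideanSpace ℝ (Fin d)) (t : EuclideanSpace ℝ (Fin d)) :
    ‖charFun (sumLaw ν a) t‖ ≤ Real.exp (-(1 / 2 * ∫ p : ℝ × ℝ,
      ∑ k, (1 - Real.cos (⟪t, a k⟫ * (p.1 - p.2))) ∂(ν.prod ν))) := by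
  have hi : ∀ k, Integrable (fun p : ℝ × ℝ => Real.cos (⟪t, a k⟫ * (p.1 - p.2)))
      (ν.prod ν) := fun k =>
    Integrable.mono' (integrable_const (1 : ℝ)) (Continuous.aestronglyMeasurable (by fun_prop))
      (Filter.Eventually.of_forall fun p => Real.abs_cos_le_one _)
  have hi' : ∀ k ∈ Finset.univ, Integrable
      (fun p : ℝ × ℝ => 1 - Real.cos (⟪t, a k⟫ * (p.1 - p.2))) (ν.prod ν) := fun k _ =>
    (integrable_const (1 : ℝ)).sub (hi k)
  rw [charFun_sumLaw, norm_prod, integral_finsetSum _ hi', Finset.mul_sum,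
    ← Finset.sum_neg_distrib, Real.exp_sum]
  refine Finset.prod_le_prod (fun k _ => norm_nonneg _) fun k _ => ?_
  rw [integral_sub (integrable_const _) (hi k), ← norm_charFun_sq_eq_integral_cos]
  simp only [integral_const, probReal_univ, smul_eq_mul, mul_one]
  refine le_of_sq_le_sq ?_ (Real.exp_pos _).le
  rw [← Real.exp_nat_mul]
  have := Real.add_one_le_exp (‖charFun ν ⟪t, a k⟫‖ ^ 2 - 1)
  calc _ ≤ Real.exp (‖charFun ν ⟪t, a k⟫‖ ^ 2 - 1) := by linarith
    _ = _ := by congr 1; push_cast; ring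

/-- Weighted Jensen inequality for `x ↦ exp (-x)`. -/
theorem exp_neg_integral_mul_le {Ω : Type*} [MeasurableSpace Ω] {P : Measure Ω} {w y : Ω → ℝ}
    (hw : ∀ p, 0 ≤ w p) (hwi : Integrable w P) (hw1 : ∫ p, w p ∂P = 1)
    (hwy : Integrable (fun p => w p * y p) P)
    (hwe : Integrable (fun p => w p * Real.exp (-y p)) P) :
    Real.exp (-∫ p, w p * y p ∂P) ≤ ∫ p, w p * Real.exp (-y p) ∂P := by
  set A := ∫ p, w p * y p ∂P with hA
  have h1 : ∫ p, Real.exp (-A) * ((1 + A) * w p - w p * y p) ∂P = Real.exp (-A) := by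
    rw [integral_const_mul, integral_sub (hwi.const_mul _) hwy, integral_const_mul, hw1]
    ring
  rw [← h1]
  refine integral_mono (((hwi.const_mul _).sub hwy).const_mul _) hwe fun p => ?_
  have h2 := Real.add_one_le_exp (A - y p)
  have h3 : Real.exp (-y p) = Real.exp (-A) * Real.exp (A - y p) := by
    rw [← Real.exp_add]
    ring_nf
  have h4 : 0 ≤ w p * Real.exp (-A) := mul_nonneg (hw p) (Real.exp_pos _).le
  dsimp only
  rw [h3]
  nlinarith [mul_le_mul_of_nonneg_left h2 h4]

theorem min_le_sum_one_sub_cos {d n : ℕ} {a : Fin n → EuclideanSpace ℝ (Fin d)}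
    {α D γ : ℝ} (hα : 0 < α) (hγ : 0 < γ)
    (h : ∀ (m : Fin n → ℤ) (t : EuclideanSpace ℝ (Fin d)), ‖t‖ ≤ D →
      min (γ * Real.sqrt (∑ k, ⟪t, a k⟫ ^ 2)) α ≤ Real.sqrt (∑ k, (⟪t, a k⟫ - m k) ^ 2))
    {t : EuclideanSpace ℝ (Fin d)} (ht : ‖t‖ ≤ D) :
    8 * min (γ ^ 2 * ∑ k, ⟪t, a k⟫ ^ 2) (α ^ 2) ≤
      ∑ k, (1 - Real.cos (2 * Real.pi * ⟪t, a k⟫)) := by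
  have hq : 0 ≤ ∑ k, ⟪t, a k⟫ ^ 2 := Finset.sum_nonneg fun k _ => sq_nonneg _
  have hs : 0 ≤ ∑ k, (⟪t, a k⟫ - round ⟪t, a k⟫) ^ 2 := Finset.sum_nonneg fun k _ => sq_nonneg _
  have h1 := h (fun k => round ⟪t, a k⟫) t ht
  have h2 : 0 ≤ min (γ * Real.sqrt (∑ k, ⟪t, a k⟫ ^ 2)) α := by positivity
  have h3 := pow_le_pow_left₀ h2 h1 2
  rw [Real.sq_sqrt hs] at h3
  have h4 : min (γ ^ 2 * ∑ k, ⟪t, a k⟫ ^ 2) (α ^ 2) ≤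
      min (γ * Real.sqrt (∑ k, ⟪t, a k⟫ ^ 2)) α ^ 2 := by
    rcases min_choice (γ * Real.sqrt (∑ k, ⟪t, a k⟫ ^ 2)) α with h | h <;> rw [h]
    · rw [mul_pow, Real.sq_sqrt hq]
      exact min_le_left _ _
    · exact min_le_right _ _
  calc _ ≤ 8 * ∑ k, (⟪t, a k⟫ - round ⟪t, a k⟫) ^ 2 := by linarith
    _ ≤ _ := by
      rw [Finset.mul_sum]
      exact Finset.sum_le_sum fun k _ => eight_mul_sq_sub_round_le _

theorem div_mul_le_div_of_mul_le {I V A B v : ENNReal} (hv : v ≠ 0) (hvV : v ≤ V) (hV : V ≠ ⊤)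
    (h : V * I ≤ A + V * B) : I ≤ A / v + B := by
  have hV0 : V ≠ 0 := fun h0 => hv (le_antisymm (h0 ▸ hvV) bot_le)
  calc I = V⁻¹ * (V * I) := by rw [← mul_assoc, ENNReal.inv_mul_cancel hV0 hV, one_mul]
    _ ≤ V⁻¹ * (A + V * B) := by gcongr
    _ = A / V + B := by
      rw [mul_add, ← mul_assoc, ENNReal.inv_mul_cancel hV0 hV, one_mul, mul_comm, div_eq_mul_inv]
    _ ≤ A / v + B := by gcongr

theorem lintegral_exp_neg_mul_exp_neg_half_le {d n : ℕ} (hd : 0 < d)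
    {a : Fin n → EuclideanSpace ℝ (Fin d)} (ha : (covMat a).PosDef)
    {H : EuclideanSpace ℝ (Fin d) → ℝ} (hHc : Continuous H)
    (hH : ∀ u v, H (u - v) ≤ 2 * H u + 2 * H v) {D w κ β : ℝ} (hD : 0 < D) (hw : 1 ≤ w)
    (hκ : 0 < κ)
    (hHl : ∀ t, ‖t‖ ≤ D / w → min ((κ * w) ^ 2 * ∑ k, ⟪t, a k⟫ ^ 2) β ≤ H t / 8) :
    ∫⁻ t : EuclideanSpace ℝ (Fin d), ENNReal.ofReal (Real.exp (-(d / D ^ 2) * ‖t‖ ^ 2)) *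
        ENNReal.ofReal (Real.exp (-(H t / 2))) ≤
      ENNReal.ofReal (Real.exp (d / 4) * (Real.pi / (d / D ^ 2)) ^ (d / 2 : ℝ) *
        ((Real.sqrt Real.pi * (Real.sqrt d / (D * κ))) ^ d * (1 / Real.sqrt (covMat a).det) +
          2 ^ d * Real.exp (-β))) := by
  have hw0 : 0 < w := by linarith
  have hd' : (0 : ℝ) < d := by exact_mod_cast hd
  have hpi := Real.pi_pos
  set b : ℝ := d / D ^ 2 with hb
  have hb0 : 0 < b := by positivity
  set ρ : ℝ := D / (2 * w) with hρ
  have hρ0 : 0 < ρ := by positivity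
  have hρ2 : 2 * ρ = D / w := by rw [hρ]; field_simp
  set V := volume (Metric.closedBall (0 : EuclideanSpace ℝ (Fin d)) ρ) with hV
  set A : ℝ := (Real.pi / (κ * w) ^ 2) ^ (d / 2 : ℝ) * (1 / Real.sqrt (covMat a).det) with hA
  have hA0 : 0 ≤ A := by positivity
  set P : ℝ := (Real.pi / b) ^ (d / 2 : ℝ) with hP
  have hP0 : 0 ≤ P := by positivity
  have hV2 : volume (Metric.closedBall (0 : EuclideanSpace ℝ (Fin d)) (2 * ρ)) =
      ENNReal.ofReal (2 ^ d) * V := by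
    rw [Measure.addHaar_closedBall_mul _ _ zero_le_two hρ0.le, finrank_euclideanSpace_fin]
  have hball : ∫⁻ u in Metric.closedBall (0 : EuclideanSpace ℝ (Fin d)) (2 * ρ),
      ENNReal.ofReal (Real.exp (-(H u / 8))) ≤
      ENNReal.ofReal A + ENNReal.ofReal (Real.exp (-β)) * (ENNReal.ofReal (2 ^ d) * V) := by
    calc _ ≤ ∫⁻ u in Metric.closedBall (0 : EuclideanSpace ℝ (Fin d)) (2 * ρ),
          (ENNReal.ofReal (Real.exp (-(κ * w) ^ 2 * ∑ k, ⟪u, a k⟫ ^ 2)) +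
            ENNReal.ofReal (Real.exp (-β))) := by
          refine setLIntegral_mono' Metric.isClosed_closedBall.measurableSet fun u hu => ?_
          rw [← ENNReal.ofReal_add (Real.exp_pos _).le (Real.exp_pos _).le]
          refine ENNReal.ofReal_le_ofReal ?_
          have h1 := hHl u (by rw [← hρ2]; exact mem_closedBall_zero_iff.1 hu)
          rcases min_le_iff.1 h1 with h2 | h2
          · have : Real.exp (-(H u / 8)) ≤ Real.exp (-(κ * w) ^ 2 * ∑ k, ⟪u, a k⟫ ^ 2) :=
              Real.exp_le_exp.2 (by linarith)
            linarith [Real.exp_pos (-β)]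
          · have : Real.exp (-(H u / 8)) ≤ Real.exp (-β) := Real.exp_le_exp.2 (by linarith)
            linarith [Real.exp_pos (-(κ * w) ^ 2 * ∑ k, ⟪u, a k⟫ ^ 2)]
      _ = (∫⁻ u in Metric.closedBall (0 : EuclideanSpace ℝ (Fin d)) (2 * ρ),
            ENNReal.ofReal (Real.exp (-(κ * w) ^ 2 * ∑ k, ⟪u, a k⟫ ^ 2))) +
            ENNReal.ofReal (Real.exp (-β)) * (ENNReal.ofReal (2 ^ d) * V) := by
          rw [lintegral_add_right _ measurable_const, setLIntegral_const, hV2]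
      _ ≤ _ := by
          rw [← lintegral_exp_neg_mul_sum_inner_sq a ha (by positivity)]
          gcongr
          exact Measure.restrict_le_self
  have hmain := volume_closedBall_mul_lintegral_le (ρ := ρ) hb0
    (g := fun t => ENNReal.ofReal (Real.exp (-(H t / 2)))) (by fun_prop)
    (fun y => (setLIntegral_exp_neg_half_le hHc hH hρ0.le y).trans hball)
  rw [finrank_euclideanSpace_fin, ← hP, ← hV] at hmain
  set v : ℝ := (2 * ρ / Real.sqrt d) ^ d with hv
  have hv0 : 0 < v := by positivity
  have hmain2 := div_mul_le_div_of_mul_le (v := ENNReal.ofReal v)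
    (A := ENNReal.ofReal (Real.exp (b * ρ ^ 2)) * ENNReal.ofReal P * ENNReal.ofReal A)
    (B := ENNReal.ofReal (Real.exp (b * ρ ^ 2)) * ENNReal.ofReal P *
      (ENNReal.ofReal (Real.exp (-β)) * ENNReal.ofReal (2 ^ d)))
    (ENNReal.ofReal_pos.2 hv0).ne' (ofReal_le_volume_closedBall d hρ0.le)
    (isCompact_closedBall _ _).measure_lt_top.ne (hmain.trans (le_of_eq (by ring)))
  refine hmain2.trans ?_
  have he0 := (Real.exp_pos (b * ρ ^ 2)).le
  rw [← ENNReal.ofReal_mul he0, ← ENNReal.ofReal_mul (by positivity),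
    ← ENNReal.ofReal_div_of_pos hv0, ← ENNReal.ofReal_mul (Real.exp_pos _).le,
    ← ENNReal.ofReal_mul (by positivity), ← ENNReal.ofReal_add (by positivity) (by positivity)]
  refine ENNReal.ofReal_le_ofReal ?_
  have hbρ : b * ρ ^ 2 ≤ d / 4 := by
    have : b * ρ ^ 2 = d / 4 / w ^ 2 := by
      rw [hb, hρ]
      field_simp
      ring
    rw [this]
    exact div_le_self (by positivity) (by nlinarith)
  have hAv : A / v = (Real.sqrt Real.pi * (Real.sqrt d / (D * κ))) ^ d *
      (1 / Real.sqrt (covMat a).det) := by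
    have h1 : (Real.pi / (κ * w) ^ 2) ^ (d / 2 : ℝ) = (Real.sqrt Real.pi / (κ * w)) ^ d := by
      rw [← Real.sqrt_sq (show 0 ≤ Real.sqrt Real.pi / (κ * w) by positivity), div_pow,
        Real.sq_sqrt hpi.le, Real.sqrt_eq_rpow, ← Real.rpow_mul_natCast (by positivity)]
      ring_nf
    rw [hA, hv, h1, hρ2, mul_div_right_comm, ← div_pow]
    congr 2
    have : 0 < Real.sqrt d := Real.sqrt_pos.2 hd'
    field_simp
  calc _ = Real.exp (b * ρ ^ 2) * P * (A / v + 2 ^ d * Real.exp (-β)) := by ring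
    _ ≤ Real.exp (d / 4) * P * (A / v + 2 ^ d * Real.exp (-β)) := by gcongr
    _ = _ := by rw [hAv]

theorem lintegral_exp_neg_mul_exp_neg_cos_le {d n : ℕ} (hd : 0 < d)
    {a : Fin n → EuclideanSpace ℝ (Fin d)} (ha : (covMat a).PosDef)
    {M α D γ : ℝ} (hM : 0 < M) (hα : 0 < α) (hD : 0 < D) (hγ : 0 < γ)
    (h : ∀ (m : Fin n → ℤ) (t : EuclideanSpace ℝ (Fin d)), ‖t‖ ≤ D →
      min (γ * Real.sqrt (∑ k, ⟪t, a k⟫ ^ 2)) α ≤ Real.sqrt (∑ k, (⟪t, a k⟫ - m k) ^ 2))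
    {z : ℝ} (hz : z ≠ 0) :
    ∫⁻ t : EuclideanSpace ℝ (Fin d), ENNReal.ofReal (Real.exp (-(d / D ^ 2) * ‖t‖ ^ 2)) *
        ENNReal.ofReal (Real.exp (-(M * (∑ k, (1 - Real.cos (2 * Real.pi * ⟪t, a k⟫ * z))) /
          min (z ^ 2) 1 / 2))) ≤
      ENNReal.ofReal (Real.exp (d / 4) * (Real.pi / (d / D ^ 2)) ^ (d / 2 : ℝ) *
        ((Real.sqrt Real.pi * (Real.sqrt d / (D * (γ * Real.sqrt M)))) ^ d *
            (1 / Real.sqrt (covMat a).det) +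
          2 ^ d * Real.exp (-(α ^ 2 * M)))) := by
  have hm0 : 0 < min (z ^ 2) 1 := lt_min (by positivity) one_pos
  have hm1 : min (z ^ 2) 1 ≤ 1 := min_le_right _ _
  have hw1 : 1 ≤ max 1 |z| := le_max_left _ _
  have hwz : max 1 |z| ^ 2 * min (z ^ 2) 1 = z ^ 2 := by
    rcases le_total |z| 1 with h' | h'
    · have : z ^ 2 ≤ 1 := (sq_le_one_iff_abs_le_one z).2 h'
      rw [max_eq_left h', min_eq_left this]
      ring
    · have : 1 ≤ z ^ 2 := (one_le_sq_iff_one_le_abs z).2 h'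
      rw [max_eq_right h', min_eq_right this, sq_abs]
      ring
  generalize min (z ^ 2) 1 = m at *
  refine lintegral_exp_neg_mul_exp_neg_half_le hd ha (by fun_prop) (fun u v => ?_) hD hw1
    (by positivity) fun t ht => ?_
  · have hsub : ∑ k, (1 - Real.cos (2 * Real.pi * ⟪u - v, a k⟫ * z)) ≤
        2 * ∑ k, (1 - Real.cos (2 * Real.pi * ⟪u, a k⟫ * z)) +
          2 * ∑ k, (1 - Real.cos (2 * Real.pi * ⟪v, a k⟫ * z)) := by
      simp only [Finset.mul_sum, ← Finset.sum_add_distrib]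
      refine Finset.sum_le_sum fun k _ => ?_
      rw [inner_sub_left, mul_sub (2 * Real.pi), sub_mul _ _ z]
      exact one_sub_cos_sub_le _ _
    refine (div_le_div_of_nonneg_right (mul_le_mul_of_nonneg_left hsub hM.le) hm0.le).trans
      (le_of_eq ?_)
    ring
  · have hzt : ‖z • t‖ ≤ D := by
      rw [norm_smul, Real.norm_eq_abs]
      rw [le_div_iff₀ (by linarith)] at ht
      have := mul_le_mul_of_nonneg_right (le_max_right 1 |z|) (norm_nonneg t)
      linarith
    have hl := min_le_sum_one_sub_cos hα hγ h hzt
    simp_rw [real_inner_smul_left, mul_pow, mul_left_comm _ z, ← Finset.mul_sum] at hl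
    simp_rw [mul_comm _ z]
    generalize ∑ k, (1 - Real.cos (z * (2 * Real.pi * ⟪t, a k⟫))) = S at *
    generalize ∑ k, ⟪t, a k⟫ ^ 2 = q at *
    rw [show M * S / m / 8 = M * (S / 8) / m by ring, le_div_iff₀ hm0, mul_pow, mul_pow,
      Real.sq_sqrt hM.le]
    refine le_trans ?_ (mul_le_mul_of_nonneg_left (show
      min (γ ^ 2 * (z ^ 2 * q)) (α ^ 2) ≤ S / 8 by linarith) hM.le)
    rw [mul_min_of_nonneg _ _ hM.le, min_mul_of_nonneg _ _ hm0.le]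
    refine min_le_min (le_of_eq ?_) ?_
    · rw [← hwz]
      ring
    · rw [mul_comm (α ^ 2)]
      exact mul_le_of_le_one_right (by positivity) hm1

/-- If `φ t ≤ exp (-E y(t))` for a weighted average `E` over `p`, then any bound on the integrals
of `g t * exp (-y p t)` that is uniform in `p` also bounds the integral of `g * φ`. -/
theorem lintegral_mul_le_of_le_exp_neg_integral {Ω E : Type*} [MeasurableSpace Ω]
    [MeasurableSpace E] {P : Measure Ω} [IsProbabilityMeasure P] {μ : Measure E} [SFinite μ]
    {w : Ω → ℝ} {y : Ω → E → ℝ} {φ : E → ℝ} {g : E → ENNReal} {T : ENNReal}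
    (hw : Measurable w) (hw0 : ∀ p, 0 ≤ w p) (hwi : Integrable w P) (hw1 : ∫ p, w p ∂P = 1)
    (hy : Measurable (Function.uncurry y)) (hy0 : ∀ p t, 0 ≤ y p t)
    (hwy : ∀ t, Integrable (fun p => w p * y p t) P)
    (hφ : ∀ t, φ t ≤ Real.exp (-∫ p, w p * y p t ∂P)) (hg : Measurable g) (hgt : ∀ t, g t ≠ ⊤)
    (hT : ∀ p, w p ≠ 0 → ∫⁻ t, g t * ENNReal.ofReal (Real.exp (-y p t)) ∂μ ≤ T) :
    ∫⁻ t, g t * ENNReal.ofReal (φ t) ∂μ ≤ T := by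
  have hwe : ∀ t, Integrable (fun p => w p * Real.exp (-y p t)) P := by
    intro t
    have hyt : Measurable fun p => y p t := hy.of_uncurry_right
    refine hwi.mono' (Measurable.aestronglyMeasurable (by fun_prop))
      (Filter.Eventually.of_forall fun p => ?_)
    rw [Real.norm_of_nonneg (mul_nonneg (hw0 p) (Real.exp_pos _).le)]
    exact mul_le_of_le_one_right (hw0 p) (Real.exp_le_one_iff.2 (neg_nonpos.2 (hy0 p t)))
  have hφ' : ∀ t, ENNReal.ofReal (φ t) ≤
      ∫⁻ p, ENNReal.ofReal (w p) * ENNReal.ofReal (Real.exp (-y p t)) ∂P := by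
    intro t
    have h2 := exp_neg_integral_mul_le hw0 hwi hw1 (hwy t) (hwe t)
    refine (ENNReal.ofReal_le_ofReal ((hφ t).trans h2)).trans (le_of_eq ?_)
    rw [ofReal_integral_eq_lintegral_ofReal (hwe t) (Filter.Eventually.of_forall fun p =>
      mul_nonneg (hw0 p) (Real.exp_pos _).le)]
    exact lintegral_congr fun p => ENNReal.ofReal_mul (hw0 p)
  have hy' : Measurable fun q : E × Ω => y q.2 q.1 := hy.comp measurable_swap
  calc _ ≤ ∫⁻ t, ∫⁻ p, g t *
          (ENNReal.ofReal (w p) * ENNReal.ofReal (Real.exp (-y p t))) ∂P ∂μ := by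
        refine lintegral_mono fun t => ?_
        rw [lintegral_const_mul' _ _ (hgt t)]
        gcongr
        exact hφ' t
    _ = ∫⁻ p, ∫⁻ t, g t *
          (ENNReal.ofReal (w p) * ENNReal.ofReal (Real.exp (-y p t))) ∂μ ∂P := by
        rw [lintegral_lintegral_swap]
        exact Measurable.aemeasurable (by simp only [Function.uncurry_def]; fun_prop)
    _ ≤ ∫⁻ p, ENNReal.ofReal (w p) * T ∂P := by
        refine lintegral_mono fun p => ?_
        simp_rw [mul_left_comm _ (ENNReal.ofReal (w p))]
        rw [lintegral_const_mul' _ _ ENNReal.ofReal_ne_top]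
        by_cases hp : w p = 0
        · simp [hp]
        · gcongr
          exact hT p hp
    _ = T := by
        rw [lintegral_mul_const _ (by fun_prop), ← ofReal_integral_eq_lintegral_ofReal
          hwi (Filter.Eventually.of_forall hw0), hw1, ENNReal.ofReal_one, one_mul]

theorem lintegral_exp_neg_mul_norm_charFun_sumLaw_le {d n : ℕ} (hd : 0 < d) (ν : Measure ℝ)
    [IsProbabilityMeasure ν] {a : Fin n → EuclideanSpace ℝ (Fin d)} (ha : (covMat a).PosDef)
    (hM : 0 < Mfn ν 1) {α D γ : ℝ} (hα : 0 < α) (hD : 0 < D) (hγ : 0 < γ)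
    (h : ∀ (m : Fin n → ℤ) (t : EuclideanSpace ℝ (Fin d)), ‖t‖ ≤ D →
      min (γ * Real.sqrt (∑ k, ⟪t, a k⟫ ^ 2)) α ≤ Real.sqrt (∑ k, (⟪t, a k⟫ - m k) ^ 2)) :
    ∫⁻ t : EuclideanSpace ℝ (Fin d), ENNReal.ofReal (Real.exp (-(d / D ^ 2) * ‖t‖ ^ 2) *
        ‖charFun (sumLaw ν a) ((2 * Real.pi) • t)‖) ≤
      ENNReal.ofReal (Real.exp (d / 4) * (Real.pi / (d / D ^ 2)) ^ (d / 2 : ℝ) *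
        ((Real.sqrt Real.pi * (Real.sqrt d / (D * (γ * Real.sqrt (Mfn ν 1))))) ^ d *
            (1 / Real.sqrt (covMat a).det) +
          2 ^ d * Real.exp (-(α ^ 2 * Mfn ν 1)))) := by
  have hm0 : ∀ p : ℝ × ℝ, 0 ≤ min ((p.1 - p.2) ^ 2) 1 := fun p =>
    le_min (sq_nonneg _) zero_le_one
  have hmi : Integrable (fun p : ℝ × ℝ => min ((p.1 - p.2) ^ 2) 1) (ν.prod ν) :=
    Integrable.mono' (integrable_const (1 : ℝ)) (Continuous.aestronglyMeasurable (by fun_prop))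
      (Filter.Eventually.of_forall fun p => by
        rw [Real.norm_of_nonneg (hm0 p)]
        exact min_le_right _ _)
  have hmM : ∫ p : ℝ × ℝ, min ((p.1 - p.2) ^ 2) 1 ∂(ν.prod ν) = Mfn ν 1 := by simp [Mfn]
  generalize Mfn ν 1 = M at *
  have hL0 : ∀ z t, 0 ≤ ∑ k, (1 - Real.cos (2 * Real.pi * ⟪t, a k⟫ * z)) := fun z t =>
    Finset.sum_nonneg fun k _ => sub_nonneg.2 (Real.cos_le_one _)
  have hwH : ∀ (p : ℝ × ℝ) (t : EuclideanSpace ℝ (Fin d)), min ((p.1 - p.2) ^ 2) 1 / M *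
      (M * (∑ k, (1 - Real.cos (2 * Real.pi * ⟪t, a k⟫ * (p.1 - p.2)))) /
        min ((p.1 - p.2) ^ 2) 1 / 2) =
      1 / 2 * ∑ k, (1 - Real.cos (2 * Real.pi * ⟪t, a k⟫ * (p.1 - p.2))) := by
    intro p t
    by_cases hp : p.1 - p.2 = 0
    · simp [hp]
    · have : 0 < min ((p.1 - p.2) ^ 2) 1 := lt_min (by positivity) one_pos
      field_simp
  have hLi : ∀ t : EuclideanSpace ℝ (Fin d), Integrable (fun p : ℝ × ℝ =>
      ∑ k, (1 - Real.cos (2 * Real.pi * ⟪t, a k⟫ * (p.1 - p.2)))) (ν.prod ν) := by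
    intro t
    refine integrable_finsetSum _ fun k _ => (integrable_const (1 : ℝ)).sub ?_
    exact Integrable.mono' (integrable_const (1 : ℝ))
      (Continuous.aestronglyMeasurable (by fun_prop))
      (Filter.Eventually.of_forall fun p => Real.abs_cos_le_one _)
  simp_rw [ENNReal.ofReal_mul (Real.exp_pos _).le]
  refine lintegral_mul_le_of_le_exp_neg_integral (P := ν.prod ν)
    (w := fun p => min ((p.1 - p.2) ^ 2) 1 / M)
    (y := fun p t => M * (∑ k, (1 - Real.cos (2 * Real.pi * ⟪t, a k⟫ * (p.1 - p.2)))) /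
        min ((p.1 - p.2) ^ 2) 1 / 2)
    (by fun_prop) (fun p => div_nonneg (hm0 p) hM.le) (hmi.div_const M)
    (by rw [integral_div, hmM, div_self hM.ne'])
    (by simp only [Function.uncurry_def]; fun_prop)
    (fun p t => div_nonneg (div_nonneg (mul_nonneg hM.le (hL0 _ _)) (hm0 p)) zero_le_two)
    (fun t => by simp_rw [hwH]; exact (hLi t).const_mul _) (fun t => ?_) (by fun_prop)
    (fun _ => ENNReal.ofReal_ne_top) fun p hp => ?_
  · have h1 := norm_charFun_sumLaw_le ν a ((2 * Real.pi) • t)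
    simp_rw [real_inner_smul_left] at h1
    simp_rw [hwH]
    rw [integral_const_mul]
    exact h1
  · exact lintegral_exp_neg_mul_exp_neg_cos_le hd ha hM hα hD hγ h fun hz => hp (by simp [hz])

theorem stmt_5 :
    ∃ c₁ c₂ : ℝ, 0 < c₁ ∧ 0 < c₂ ∧
      ∀ (d n : ℕ), 0 < d →
      ∀ (ν : Measure ℝ), IsProbabilityMeasure ν →
      ∀ (a : Fin n → EuclideanSpace ℝ (Fin d)),
      (covMat a).PosDef →
      0 < Mfn ν 1 →
      ∀ α D γ : ℝ, 0 < α → 0 < D → 0 < γ → γ < 1 →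
      (∀ (m : Fin n → ℤ) (t : EuclideanSpace ℝ (Fin d)),
        ‖t‖ ≤ D →
        min (γ * Real.sqrt (∑ k, ⟪t, a k⟫ ^ 2)) α ≤
          Real.sqrt (∑ k, (⟪t, a k⟫ - m k) ^ 2)) →
      concFn (sumLaw ν a) (d / D) ≤
        c₁ ^ d * ((Real.sqrt d / (D * γ * Real.sqrt (Mfn ν 1))) ^ d
            * (1 / Real.sqrt (covMat a).det)
          + Real.exp (-c₂ * α ^ 2 * Mfn ν 1)) := by
  refine ⟨2 * Real.exp (Real.pi ^ 2 + 1 / 4), 1, by positivity, one_pos, ?_⟩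
  intro d n hd ν hν a ha hM α D γ hα hD hγ _ h
  have hpi := Real.pi_pos
  have hd' : (0 : ℝ) < d := by exact_mod_cast hd
  have := isProbabilityMeasure_sumLaw ν a
  refine ciSup_le fun x => ?_
  set X : ℝ := Real.sqrt d / (D * γ * Real.sqrt (Mfn ν 1)) with hX
  have hX0 : 0 ≤ X := by positivity
  have hb : 0 < d / D ^ 2 := by positivity
  set P : ℝ := (Real.pi / (d / D ^ 2)) ^ (d / 2 : ℝ) with hP
  have hP0 : 0 < P := by positivity
  have hPinv : ((d / D ^ 2) / Real.pi) ^ (d / 2 : ℝ) = P⁻¹ := by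
    rw [hP, ← Real.inv_rpow (by positivity), inv_div]
  have h1 := measureReal_closedBall_le_integral_charFun (sumLaw ν a) hb x (d / D)
  have h2 := lintegral_exp_neg_mul_norm_charFun_sumLaw_le hd ν ha hM hα hD hγ h
  rw [← mul_assoc D γ, ← hX, ← hP] at h2
  have h3 : ∫ t : EuclideanSpace ℝ (Fin d), Real.exp (-(d / D ^ 2) * ‖t‖ ^ 2) *
      ‖charFun (sumLaw ν a) ((2 * Real.pi) • t)‖ ≤ Real.exp (d / 4) * P *
        ((Real.sqrt Real.pi * X) ^ d * (1 / Real.sqrt (covMat a).det) +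
          2 ^ d * Real.exp (-(α ^ 2 * Mfn ν 1))) := by
    have hcm : Measurable fun t : EuclideanSpace ℝ (Fin d) =>
        ‖charFun (sumLaw ν a) ((2 * Real.pi) • t)‖ :=
      (stronglyMeasurable_charFun.measurable.comp (measurable_const_smul _)).norm
    rw [integral_eq_lintegral_of_nonneg_ae
      (Filter.Eventually.of_forall fun t => mul_nonneg (Real.exp_pos _).le (norm_nonneg _))
      (Measurable.aestronglyMeasurable (by fun_prop))]
    exact ENNReal.toReal_le_of_le_ofReal (by positivity) h2
  have hr : Real.pi ^ 2 * (d / D) ^ 2 / (d / D ^ 2) = d * Real.pi ^ 2 := by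
    field_simp
  have hsqrt : Real.sqrt Real.pi ≤ 2 := by
    rw [Real.sqrt_le_left (by norm_num)]
    linarith [Real.pi_le_four]
  rw [hr, finrank_euclideanSpace_fin, hPinv] at h1
  calc (sumLaw ν a (Metric.closedBall x (d / D))).toReal
      ≤ Real.exp (d * Real.pi ^ 2) * (P⁻¹ * (Real.exp (d / 4) * P *
        ((Real.sqrt Real.pi * X) ^ d * (1 / Real.sqrt (covMat a).det) +
          2 ^ d * Real.exp (-(α ^ 2 * Mfn ν 1))))) := by
        refine h1.trans ?_
        gcongr
    _ = Real.exp (d * Real.pi ^ 2) * Real.exp (d / 4) *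
        ((Real.sqrt Real.pi * X) ^ d * (1 / Real.sqrt (covMat a).det) +
          2 ^ d * Real.exp (-(α ^ 2 * Mfn ν 1))) := by
        field_simp
    _ ≤ Real.exp (d * Real.pi ^ 2) * Real.exp (d / 4) *
        ((2 * X) ^ d * (1 / Real.sqrt (covMat a).det) +
          2 ^ d * Real.exp (-(α ^ 2 * Mfn ν 1))) := by
        gcongr
    _ = (2 * Real.exp (Real.pi ^ 2 + 1 / 4)) ^ d * (X ^ d * (1 / Real.sqrt (covMat a).det) +
          Real.exp (-1 * α ^ 2 * Mfn ν 1)) := by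
        have he : Real.exp (d * Real.pi ^ 2) * Real.exp (d / 4) =
            Real.exp (Real.pi ^ 2 + 1 / 4) ^ d := by
          rw [← Real.exp_add, ← Real.exp_nat_mul]
          ring_nf
        rw [he, mul_pow, mul_pow, show -1 * α ^ 2 * Mfn ν 1 = -(α ^ 2 * Mfn ν 1) by ring]
        ring
end
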